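/- For all integers p ≥ 2 and k ≥ 2p, one has Σ_k^p ≥ (2⌊k/p⌋ − 1)·pπ, where ⌊·⌋ is the floor function. (Theorem 4.3(ii) of the paper.) -/

import Mathlib

open Set MeasureTheory Metric Filter Asymptotics
open scoped ENNReal Topology NNReal

noncomputable section

abbrev E2 : Type := EuclideanSpace ℝ (Fin 2)

def IsLipschitzDomain (Ω : Set E2) : Prop :=
  IsOpen Ω ∧ IsConnected Ω ∧ Bornology.IsBounded Ω ∧
    ∀ p ∈ frontier Ω, ∃ (e : E2 ≃ₗᵢ[ℝ] E2) (K : ℝ≥0) (φ : ℝ → ℝ) (U : Set E2),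
      LipschitzWith K φ ∧ IsOpen U ∧ p ∈ U ∧
      ∀ x ∈ U, (x ∈ Ω ↔ φ (e x 0) < e x 1)

def dirEnergy (Ω : Set E2) (f : E2 → ℝ) : ℝ≥0∞ :=
  ∫⁻ x in Ω, (‖fderiv ℝ f x‖₊ : ℝ≥0∞) ^ 2

def bdryInt (Γ : Set E2) (ρ f : E2 → ℝ) : ℝ≥0∞ :=
  ∫⁻ x in Γ, ENNReal.ofReal (ρ x * (f x) ^ 2) ∂μH[1]

def rayleigh (Ω Γ : Set E2) (ρ f : E2 → ℝ) : ℝ≥0∞ :=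
  dirEnergy Ω f / bdryInt Γ ρ f

def steklovMixed (Ω ΓS ΓD : Set E2) (ρ : E2 → ℝ) (k : ℕ) : ℝ≥0∞ :=
  ⨅ (V : Submodule ℝ (E2 → ℝ))
    (_ : Module.finrank ℝ V = k + 1)
    (_ : ∀ f ∈ V, ContDiff ℝ (⊤ : ℕ∞) f)
    (_ : ∀ f ∈ V, ∀ᶠ x in nhdsSet ΓD, f x = 0)
    (_ : ∀ f ∈ V, Set.EqOn f 0 (closure Ω) → f = 0),
    ⨆ f ∈ V, ⨆ (_ : ¬ Set.EqOn f 0 (closure Ω)), rayleigh Ω ΓS ρ f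

def steklovN (Ω ΓS : Set E2) (k : ℕ) : ℝ≥0∞ :=
  steklovMixed Ω ΓS ∅ (fun _ => 1) k

def steklovD (Ω ΓS ΓD : Set E2) (k : ℕ) : ℝ≥0∞ :=
  steklovMixed Ω ΓS ΓD (fun _ => 1) k

def steklovW (Ω : Set E2) (ρ : E2 → ℝ) (k : ℕ) : ℝ≥0∞ :=
  steklovMixed Ω (frontier Ω) ∅ ρ k

def steklov (Ω : Set E2) (k : ℕ) : ℝ≥0∞ := steklovW Ω (fun _ => 1) k

def IsArc (A : Set E2) : Prop :=
  ∃ γ : ℝ → E2, ContinuousOn γ (Icc 0 1) ∧ InjOn γ (Icc 0 1) ∧ A = γ '' Icc 0 1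

def IsLoop (A : Set E2) : Prop :=
  ∃ γ : ℝ → E2, ContinuousOn γ (Icc 0 1) ∧ InjOn γ (Ico 0 1) ∧ γ 0 = γ 1 ∧ A = γ '' Icc 0 1

def IsBoundaryPart (Γ : Set E2) : Prop :=
  ∃ F : Finset (Set E2), (∀ A ∈ F, IsArc A ∨ IsLoop A) ∧ Γ = ⋃₀ ↑F

structure SteklovDecomp (Ω ΓS Γstar : Set E2) : Prop where
  partS : IsBoundaryPart ΓS
  partStar : IsBoundaryPart Γstar
  union_eq : ΓS ∪ Γstar = frontier Ω
  inter_finite : (ΓS ∩ Γstar).Finite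
  nonemptyS : ΓS.Nonempty

/-- Rotation of the plane by angle θ about the origin. -/
def rotBy (θ : ℝ) : E2 → E2 := fun x =>
  (WithLp.equiv 2 (Fin 2 → ℝ)).symm
    ![Real.cos θ * x 0 - Real.sin θ * x 1, Real.sin θ * x 0 + Real.cos θ * x 1]

/-- The class 𝒟_p: simply connected bounded Lipschitz planar domains with rotational
symmetry of order p about the origin, together with a nonnegative rotationally
symmetric L^∞ weight on the boundary that is positive on a set of positive H¹ measure. -/
def MemDp (p : ℕ) (Ω : Set E2) (ρ : E2 → ℝ) : Prop :=
  IsLipschitzDomain Ω ∧ SimplyConnectedSpace Ω ∧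
  rotBy (2 * Real.pi / p) '' Ω = Ω ∧
  (∀ x, 0 ≤ ρ x) ∧
  (∃ C : ℝ, ∀ᵐ x ∂(μH[1].restrict (frontier Ω)), ρ x ≤ C) ∧
  0 < μH[1] {x ∈ frontier Ω | 0 < ρ x} ∧
  (∀ x ∈ frontier Ω, ρ (rotBy (2 * Real.pi / p) x) = ρ x)

/-- The ρ-weighted length L_ρ(∂Ω). -/
def Lweight (Ω : Set E2) (ρ : E2 → ℝ) : ℝ≥0∞ :=
  ∫⁻ x in frontier Ω, ENNReal.ofReal (ρ x) ∂μH[1]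

/-- Σ_k^p, the supremum of the normalized k-th Steklov eigenvalue over 𝒟_p. -/
def SigmaP (p k : ℕ) : ℝ≥0∞ :=
  ⨆ (Ω : Set E2) (ρ : E2 → ℝ) (_ : MemDp p Ω ρ), steklovW Ω ρ k * Lweight Ω ρ

namespace DiskSteklov

open scoped ComplexConjugate

/-- Average over the unit circle. -/
abbrev cavg {E : Type*} [NormedAddCommGroup E] [NormedSpace ℝ E] (h : ℂ → E) : E :=
  Real.circleAverage h 0 1

/-- The Blaschke factor of the unit disk vanishing at `a`. -/
def blaschke (a z : ℂ) : ℂ := (z - a) / (1 - conj a * z)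

/-- The backward shift adapted to the Blaschke factor at `a`. -/
def bshift (a : ℂ) (G : ℂ → ℂ) (z : ℂ) : ℂ := dslope G a z * (1 - conj a * z)

/-- The point `a` of the unit disk has its pole `1 / conj a` outside the disk of radius `R > 1`. -/
structure Admissible (R : ℝ) (a : ℂ) : Prop where
  one_lt : 1 < R
  mul_le : ‖a‖ * R ≤ 1

lemma Admissible.norm_lt {R : ℝ} {a : ℂ} (h : Admissible R a) : ‖a‖ < 1 := by
  by_contra! hc
  have := h.one_lt; have := h.mul_le
  nlinarith

lemma Admissible.mem_ball {R : ℝ} {a : ℂ} (h : Admissible R a) : a ∈ ball (0 : ℂ) R := by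
  have := h.one_lt; have := h.norm_lt
  rw [mem_ball_zero_iff]; linarith

lemma Admissible.denom_ne {R : ℝ} {a : ℂ} (h : Admissible R a) {z : ℂ} (hz : z ∈ ball (0 : ℂ) R) :
    1 - conj a * z ≠ 0 := by
  intro h0
  have h1 : conj a * z = 1 := (sub_eq_zero.mp h0).symm
  have h2 : ‖a‖ * ‖z‖ = 1 := by
    rw [← RCLike.norm_conj a, ← norm_mul, h1, norm_one]
  rw [mem_ball_zero_iff] at hz
  have := h.mul_le
  have h3 : 0 < ‖a‖ := by
    rcases (norm_nonneg a).lt_or_eq with h4 | h4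
    · exact h4
    · rw [← h4] at h2; simp at h2
  nlinarith

lemma sphere_subset_ball {R : ℝ} (hR : 1 < R) : sphere (0 : ℂ) 1 ⊆ ball 0 R := by
  intro z hz
  rw [mem_sphere_zero_iff_norm] at hz
  rw [mem_ball_zero_iff, hz]; exact hR

lemma conj_eq_inv {z : ℂ} (hz : z ∈ sphere (0 : ℂ) 1) : conj z = z⁻¹ := by
  rw [mem_sphere_zero_iff_norm] at hz
  exact (Complex.inv_eq_conj hz).symm

lemma ne_zero_of_mem_sphere' {z : ℂ} (hz : z ∈ sphere (0 : ℂ) 1) : z ≠ 0 :=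
  ne_zero_of_mem_unit_sphere ⟨z, hz⟩

lemma sub_ne_zero_of_sphere {a z : ℂ} (ha : ‖a‖ < 1) (hz : z ∈ sphere (0 : ℂ) 1) : z - a ≠ 0 := by
  intro h
  rw [mem_sphere_zero_iff_norm, sub_eq_zero.mp h] at hz
  linarith

lemma poissonKernel_eq {a z : ℂ} (hz : z ∈ sphere (0 : ℂ) 1) :
    (poissonKernel 0 a z : ℂ) = (1 - a * conj a) / ((z - a) * conj (z - a)) := by
  rw [mem_sphere_zero_iff_norm] at hz
  simp only [poissonKernel_def, sub_zero, hz, Complex.mul_conj, Complex.normSq_eq_norm_sq]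
  push_cast; norm_num

lemma poissonKernel_pos {a z : ℂ} (ha : ‖a‖ < 1) (hz : z ∈ sphere (0 : ℂ) 1) :
    0 < poissonKernel 0 a z := by
  have h0 := norm_pos_iff.mpr (sub_ne_zero_of_sphere ha hz)
  rw [mem_sphere_zero_iff_norm] at hz
  simp only [poissonKernel_def, sub_zero, hz]
  have : ‖a‖ ^ 2 < 1 := by nlinarith [norm_nonneg a]
  exact div_pos (by linarith) (by positivity)

lemma continuousOn_poissonKernel {a : ℂ} (ha : ‖a‖ < 1) :
    ContinuousOn (fun z => poissonKernel 0 a z) (sphere (0 : ℂ) 1) := by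
  simp only [poissonKernel_def, sub_zero]
  refine ContinuousOn.div (by fun_prop) (by fun_prop) fun z hz => ?_
  exact pow_ne_zero _ (norm_ne_zero_iff.mpr (sub_ne_zero_of_sphere ha hz))

section Blaschke
variable {R : ℝ} {a : ℂ}

lemma blaschke_self (a : ℂ) : blaschke a a = 0 := by simp [blaschke]

lemma blaschke_zero (z : ℂ) : blaschke 0 z = z := by simp [blaschke]

lemma differentiableOn_blaschke (h : Admissible R a) :
    DifferentiableOn ℂ (blaschke a) (ball 0 R) := by
  refine DifferentiableOn.div (by fun_prop) (by fun_prop) fun z hz => h.denom_ne hz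

lemma hasDerivAt_blaschke (h : Admissible R a) {z : ℂ} (hz : z ∈ ball (0 : ℂ) R) :
    HasDerivAt (blaschke a) ((1 - a * conj a) / (1 - conj a * z) ^ 2) z := by
  have h1 : HasDerivAt (fun z => z - a) 1 z := (hasDerivAt_id z).sub_const a
  have h2 : HasDerivAt (fun z => 1 - conj a * z) (-conj a) z := by
    simpa using ((hasDerivAt_id z).const_mul (conj a)).const_sub 1
  exact (h1.div h2 (h.denom_ne hz)).congr_deriv (by congr 1; ring)

lemma denom_eq {z : ℂ} (hz : z ∈ sphere (0 : ℂ) 1) : 1 - conj a * z = z * conj (z - a) := by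
  rw [map_sub, conj_eq_inv hz, mul_sub, mul_inv_cancel₀ (ne_zero_of_mem_sphere' hz), mul_comm]

lemma blaschke_mul_conj (h : Admissible R a) {z : ℂ} (hz : z ∈ sphere (0 : ℂ) 1) :
    blaschke a z * conj (blaschke a z) = 1 := by
  have h0 := ne_zero_of_mem_sphere' hz
  have h1 := sub_ne_zero_of_sphere h.norm_lt hz
  have h2 : conj (z - a) ≠ 0 := (map_ne_zero _).mpr h1
  rw [blaschke, denom_eq hz, map_div₀, map_mul, Complex.conj_conj, conj_eq_inv hz]
  field_simp

lemma norm_blaschke (h : Admissible R a) {z : ℂ} (hz : z ∈ sphere (0 : ℂ) 1) :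
    ‖blaschke a z‖ = 1 := by
  have h1 := blaschke_mul_conj h hz
  rw [Complex.mul_conj, Complex.normSq_eq_norm_sq] at h1
  have h2 : ‖blaschke a z‖ ^ 2 = 1 := by exact_mod_cast h1
  nlinarith [norm_nonneg (blaschke a z)]

lemma mul_deriv_blaschke (h : Admissible R a) {z : ℂ} (hz : z ∈ sphere (0 : ℂ) 1) :
    z * deriv (blaschke a) z = poissonKernel 0 a z * blaschke a z := by
  have h0 := ne_zero_of_mem_sphere' hz
  have h1 := sub_ne_zero_of_sphere h.norm_lt hz
  have h2 : conj (z - a) ≠ 0 := (map_ne_zero _).mpr h1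
  rw [(hasDerivAt_blaschke h (sphere_subset_ball h.one_lt hz)).deriv, poissonKernel_eq hz,
    blaschke, denom_eq hz]
  field_simp

lemma differentiableOn_bshift (h : Admissible R a) {G : ℂ → ℂ}
    (hG : DifferentiableOn ℂ G (ball 0 R)) : DifferentiableOn ℂ (bshift a G) (ball 0 R) := by
  have : DifferentiableOn ℂ (dslope G a) (ball 0 R) :=
    (Complex.differentiableOn_dslope (isOpen_ball.mem_nhds h.mem_ball)).mpr hG
  exact this.mul (by fun_prop)

lemma eq_add_blaschke_mul_bshift (h : Admissible R a) (G : ℂ → ℂ) {z : ℂ}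
    (hz : z ∈ ball (0 : ℂ) R) : G z = G a + blaschke a z * bshift a G z := by
  have h1 := h.denom_ne hz
  have h2 : (z - a) * dslope G a z = G z - G a := by simpa using sub_smul_dslope G a z
  have h3 : blaschke a z * bshift a G z = (z - a) * dslope G a z := by
    rw [blaschke, bshift, div_mul_eq_mul_div, mul_comm (dslope G a z), ← mul_assoc,
      mul_comm (z - a), mul_assoc, mul_div_cancel_left₀ _ h1]
  rw [h3, h2]; ring

end Blaschke

section Averages
variable {R : ℝ} {a : ℂ}

lemma circleIntegrable' {E : Type*} [NormedAddCommGroup E] {h : ℂ → E}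
    (hh : ContinuousOn h (sphere 0 1)) : CircleIntegrable h 0 1 :=
  hh.circleIntegrable zero_le_one

lemma cavg_congr {E : Type*} [NormedAddCommGroup E] [NormedSpace ℝ E] {f g : ℂ → E}
    (h : ∀ z ∈ sphere (0 : ℂ) 1, f z = g z) : cavg f = cavg g :=
  Real.circleAverage_congr_sphere (by rw [abs_one]; exact h)

lemma cavg_add {E : Type*} [NormedAddCommGroup E] [NormedSpace ℝ E] {f g : ℂ → E}
    (hf : ContinuousOn f (sphere 0 1)) (hg : ContinuousOn g (sphere 0 1)) :
    cavg (fun z => f z + g z) = cavg f + cavg g :=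
  Real.circleAverage_add (circleIntegrable' hf) (circleIntegrable' hg)

lemma cavg_sub {E : Type*} [NormedAddCommGroup E] [NormedSpace ℝ E] {f g : ℂ → E}
    (hf : ContinuousOn f (sphere 0 1)) (hg : ContinuousOn g (sphere 0 1)) :
    cavg (fun z => f z - g z) = cavg f - cavg g :=
  Real.circleAverage_sub (circleIntegrable' hf) (circleIntegrable' hg)

lemma cavg_sum {E : Type*} [NormedAddCommGroup E] [NormedSpace ℝ E] {ι : Type*} (s : Finset ι)
    {f : ι → ℂ → E} (hf : ∀ i ∈ s, ContinuousOn (f i) (sphere 0 1)) :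
    cavg (fun z => ∑ i ∈ s, f i z) = ∑ i ∈ s, cavg (f i) :=
  Real.circleAverage_fun_sum fun i hi => circleIntegrable' (hf i hi)

lemma cavg_const_mul (c : ℂ) (f : ℂ → ℂ) : cavg (fun z => c * f z) = c * cavg f :=
  Real.circleAverage_fun_smul (𝕜 := ℂ) (a := c) (f := f)

lemma cavg_const_mul_real (c : ℝ) (f : ℂ → ℝ) : cavg (fun z => c * f z) = c * cavg f :=
  Real.circleAverage_fun_smul (𝕜 := ℝ) (a := c) (f := f)

lemma cavg_conj (f : ℂ → ℂ) : cavg (fun z => conj (f z)) = conj (cavg f) := by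
  simp only [cavg, Real.circleAverage_def, Complex.real_smul, map_mul, Complex.conj_ofReal]
  simp only [intervalIntegral.integral_of_le Real.two_pi_pos.le, integral_conj]

lemma cavg_re {f : ℂ → ℂ} (hf : ContinuousOn f (sphere 0 1)) :
    cavg (fun z => (f z).re) = (cavg f).re :=
  Complex.reCLM.circleAverage_comp_comm (circleIntegrable' hf)

lemma cavg_ofReal (f : ℂ → ℝ) : cavg (fun z => (f z : ℂ)) = ((cavg f : ℝ) : ℂ) := by
  simp only [cavg, Real.circleAverage_def, Complex.real_smul]
  rw [intervalIntegral.integral_ofReal]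
  simp

lemma cavg_mono {f g : ℂ → ℝ} (hf : ContinuousOn f (sphere 0 1)) (hg : ContinuousOn g (sphere 0 1))
    (h : ∀ z ∈ sphere (0 : ℂ) 1, f z ≤ g z) : cavg f ≤ cavg g :=
  Real.circleAverage_mono (circleIntegrable' hf) (circleIntegrable' hg) (by simpa using h)

lemma cavg_nonneg {f : ℂ → ℝ} (h : ∀ z ∈ sphere (0 : ℂ) 1, 0 ≤ f z) : 0 ≤ cavg f :=
  Real.circleAverage_nonneg_of_nonneg (by simpa using h)

lemma continuousOn_ofReal_poissonKernel (ha : ‖a‖ < 1) :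
    ContinuousOn (fun z => (poissonKernel 0 a z : ℂ)) (sphere (0 : ℂ) 1) :=
  Complex.continuous_ofReal.comp_continuousOn (continuousOn_poissonKernel ha)

lemma cavg_poissonKernel_mul (h : Admissible R a) {G : ℂ → ℂ}
    (hG : DifferentiableOn ℂ G (ball 0 R)) :
    cavg (fun z => (poissonKernel 0 a z : ℂ) * G z) = G a := by
  have h1 : DiffContOnCl ℂ G (ball 0 1) :=
    (hG.mono (closedBall_subset_ball h.one_lt)).diffContOnCl_ball subset_rfl
  have := h1.circleAverage_poissonKernel_smul (w := a) (by simpa using h.norm_lt)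
  rw [← this]
  refine cavg_congr fun z hz => ?_
  simp

lemma cavg_poissonKernel (h : Admissible R a) : cavg (fun z => poissonKernel 0 a z) = 1 := by
  have := cavg_poissonKernel_mul h (G := fun _ => 1) (by fun_prop)
  simp only [mul_one] at this
  rw [cavg_ofReal] at this
  exact_mod_cast this

lemma cavg_eq_apply_zero (hR : 1 < R) {G : ℂ → ℂ} (hG : DifferentiableOn ℂ G (ball 0 R)) :
    cavg G = G 0 := by
  have h1 : DiffContOnCl ℂ G (ball 0 1) :=
    (hG.mono (closedBall_subset_ball hR)).diffContOnCl_ball subset_rfl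
  exact DiffContOnCl.circleAverage (by simpa using h1)

end Averages

/-- Square of the norm in `L²` of the harmonic measure with pole `a`. -/
def poissonSq (a : ℂ) (G : ℂ → ℂ) : ℝ := cavg (fun z => poissonKernel 0 a z * ‖G z‖ ^ 2)

/-- The Dirichlet inner product, written as an integral over the unit circle. -/
def dirInner (G H : ℂ → ℂ) : ℂ := cavg (fun z => z * deriv G z * conj (H z))

/-- The Dirichlet energy, written as an integral over the unit circle. -/
def dirSq (G : ℂ → ℂ) : ℝ := (dirInner G G).re

/-- Coefficient of `G` along the power `l` of the Blaschke factor at `a`. -/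
def blaschkeCoeff (a : ℂ) (l : ℕ) (G : ℂ → ℂ) : ℂ :=
  cavg (fun z => (poissonKernel 0 a z : ℂ) * (G z * conj (blaschke a z) ^ l))

section Dirichlet
variable {R : ℝ} {a : ℂ} {G H : ℂ → ℂ}

lemma continuousOn_sphere (hR : 1 < R) (hG : DifferentiableOn ℂ G (ball 0 R)) :
    ContinuousOn G (sphere 0 1) := hG.continuousOn.mono (sphere_subset_ball hR)

lemma differentiableOn_deriv (hG : DifferentiableOn ℂ G (ball 0 R)) :
    DifferentiableOn ℂ (deriv G) (ball 0 R) := hG.deriv isOpen_ball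

lemma continuousOn_deriv (hR : 1 < R) (hG : DifferentiableOn ℂ G (ball 0 R)) :
    ContinuousOn (deriv G) (sphere 0 1) := continuousOn_sphere hR (differentiableOn_deriv hG)

lemma continuousOn_blaschke (h : Admissible R a) : ContinuousOn (blaschke a) (sphere 0 1) :=
  continuousOn_sphere h.one_lt (differentiableOn_blaschke h)

lemma continuousOn_conj {f : ℂ → ℂ} {s : Set ℂ} (hf : ContinuousOn f s) :
    ContinuousOn (fun z => conj (f z)) s := Complex.continuous_conj.comp_continuousOn hf

lemma poissonSq_eq_add (h : Admissible R a) (hG : DifferentiableOn ℂ G (ball 0 R)) :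
    poissonSq a G = ‖G a‖ ^ 2 + poissonSq a (bshift a G) := by
  have hB := differentiableOn_bshift h hG
  have hBc := continuousOn_sphere h.one_lt hB
  have hP := continuousOn_poissonKernel h.norm_lt
  have hPc := continuousOn_ofReal_poissonKernel h.norm_lt
  have hb := continuousOn_blaschke h
  have key : ∀ z ∈ sphere (0 : ℂ) 1, poissonKernel 0 a z * ‖G z‖ ^ 2 =
      (‖G a‖ ^ 2 * poissonKernel 0 a z + poissonKernel 0 a z * ‖bshift a G z‖ ^ 2) +
      ((poissonKernel 0 a z : ℂ) * (2 * conj (G a) * (blaschke a z * bshift a G z))).re := by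
    intro z hz
    rw [Complex.re_ofReal_mul, eq_add_blaschke_mul_bshift h G (sphere_subset_ball h.one_lt hz),
      ← Complex.normSq_eq_norm_sq, Complex.normSq_add]
    simp only [map_mul, Complex.normSq_eq_norm_sq, norm_blaschke h hz]
    have : (G a * ((starRingEnd ℂ) (blaschke a z) * (starRingEnd ℂ) (bshift a G z))).re =
        (conj (G a) * (blaschke a z * bshift a G z)).re := by
      rw [← Complex.conj_re]; simp
    have h2 : ∀ w : ℂ, (2 * w).re = 2 * w.re := fun w => by simp
    rw [this, mul_assoc 2, h2]
    ring
  have hre : ContinuousOn (fun z => ((poissonKernel 0 a z : ℂ) *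
      (2 * conj (G a) * (blaschke a z * bshift a G z))).re) (sphere 0 1) :=
    Complex.continuous_re.comp_continuousOn (by fun_prop)
  rw [poissonSq, cavg_congr key, cavg_add (by fun_prop) hre,
    cavg_add (by fun_prop) (by fun_prop), cavg_const_mul_real, cavg_poissonKernel h, cavg_re
    (by fun_prop), cavg_poissonKernel_mul h (G := fun z => 2 * conj (G a) * (blaschke a z *
      bshift a G z)) (by have := differentiableOn_blaschke h; fun_prop), blaschke_self]
  simp [poissonSq]

lemma cavg_mul_deriv (hR : 1 < R) (hG : DifferentiableOn ℂ G (ball 0 R)) :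
    cavg (fun z => z * deriv G z) = 0 := by
  have := differentiableOn_deriv hG
  rw [cavg_eq_apply_zero hR (by fun_prop)]; simp

lemma hasDerivAt_of_mem (hG : DifferentiableOn ℂ G (ball 0 R)) {z : ℂ} (hz : z ∈ ball (0 : ℂ) R) :
    HasDerivAt G (deriv G z) z := (hG.differentiableAt (isOpen_ball.mem_nhds hz)).hasDerivAt

/-- Carleson's formula for the Dirichlet energy of a product with a Blaschke factor. -/
lemma dirSq_eq_add (h : Admissible R a) (hG : DifferentiableOn ℂ G (ball 0 R)) :
    dirSq G = dirSq (bshift a G) + poissonSq a (bshift a G) := by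
  have hB := differentiableOn_bshift h hG
  have hBc := continuousOn_sphere h.one_lt hB
  have hBd := continuousOn_deriv h.one_lt hB
  have hGd := continuousOn_deriv h.one_lt hG
  have hP := continuousOn_poissonKernel h.norm_lt
  have hPc := continuousOn_ofReal_poissonKernel h.norm_lt
  have hb := continuousOn_blaschke h
  have key : ∀ z ∈ sphere (0 : ℂ) 1, z * deriv G z * conj (G z) =
      (z * deriv (bshift a G) z * conj (bshift a G z) +
      ((poissonKernel 0 a z * ‖bshift a G z‖ ^ 2 : ℝ) : ℂ)) +
      conj (G a) * (z * deriv G z) := by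
    intro z hz
    have hz' := sphere_subset_ball h.one_lt hz
    have hd : deriv G z = deriv (blaschke a) z * bshift a G z +
        blaschke a z * deriv (bshift a G) z := by
      have h1 : HasDerivAt (fun z => G a + blaschke a z * bshift a G z) _ z :=
        ((hasDerivAt_of_mem (differentiableOn_blaschke h) hz').mul
          (hasDerivAt_of_mem hB hz')).const_add (G a)
      refine (h1.congr_of_eventuallyEq ?_).deriv
      filter_upwards [isOpen_ball.mem_nhds hz'] with w hw
      exact eq_add_blaschke_mul_bshift h G hw
    have hc : conj (G z) = conj (G a) + conj (blaschke a z) * conj (bshift a G z) := by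
      rw [eq_add_blaschke_mul_bshift h G hz', map_add, map_mul]
    have e1 := mul_deriv_blaschke h hz
    have e2 := blaschke_mul_conj h hz
    push_cast
    rw [← Complex.mul_conj', hc]
    have e3 : z * deriv G z = poissonKernel 0 a z * blaschke a z * bshift a G z +
        z * blaschke a z * deriv (bshift a G) z := by
      rw [hd, ← e1]; ring
    rw [e3]
    linear_combination (poissonKernel 0 a z * bshift a G z * conj (bshift a G z) +
      z * deriv (bshift a G) z * conj (bshift a G z)) * e2
  have hr : ContinuousOn (fun z => ((poissonKernel 0 a z * ‖bshift a G z‖ ^ 2 : ℝ) : ℂ))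
      (sphere 0 1) := Complex.continuous_ofReal.comp_continuousOn (by fun_prop)
  have hr2 : ContinuousOn (fun z => z * deriv (bshift a G) z * conj (bshift a G z))
    (sphere 0 1) := by have := continuousOn_conj hBc; fun_prop
  have hr3 : ContinuousOn (fun z => z * deriv (bshift a G) z * conj (bshift a G z) +
      ((poissonKernel 0 a z * ‖bshift a G z‖ ^ 2 : ℝ) : ℂ)) (sphere 0 1) := hr2.add hr
  rw [dirSq, dirInner, cavg_congr key, cavg_add hr3 (by fun_prop), cavg_add hr2 hr,
    cavg_const_mul, cavg_mul_deriv h.one_lt hG, cavg_ofReal]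
  simp [dirSq, dirInner, poissonSq]

lemma poissonSq_nonneg (ha : ‖a‖ < 1) (G : ℂ → ℂ) : 0 ≤ poissonSq a G := by
  unfold poissonSq
  exact cavg_nonneg fun _ hz => mul_nonneg (poissonKernel_pos ha hz).le (sq_nonneg _)

lemma differentiableOn_bshift_iterate (h : Admissible R a) (hG : DifferentiableOn ℂ G (ball 0 R))
    (l : ℕ) : DifferentiableOn ℂ ((bshift a)^[l] G) (ball 0 R) := by
  induction l with
  | zero => simpa
  | succ l ih => rw [Function.iterate_succ_apply']; exact differentiableOn_bshift h ih

lemma poissonSq_eq_sum (h : Admissible R a) (hG : DifferentiableOn ℂ G (ball 0 R)) (l : ℕ) :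
    poissonSq a G = ∑ k ∈ Finset.range l, ‖(bshift a)^[k] G a‖ ^ 2 +
      poissonSq a ((bshift a)^[l] G) := by
  induction l with
  | zero => simp
  | succ l ih =>
    rw [ih, poissonSq_eq_add h (differentiableOn_bshift_iterate h hG l), Finset.sum_range_succ,
      Function.iterate_succ_apply']
    ring

lemma mul_poissonSq_iterate_le (h : Admissible R a) (hG : DifferentiableOn ℂ G (ball 0 R))
    (l : ℕ) : dirSq ((bshift a)^[l] G) + l * poissonSq a ((bshift a)^[l] G) ≤ dirSq G := by
  induction l with
  | zero => simp
  | succ l ih =>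
    have hl := differentiableOn_bshift_iterate h hG l
    have h1 := dirSq_eq_add h hl
    have h2 := poissonSq_eq_add h hl
    rw [Function.iterate_succ_apply']
    have : (l : ℝ) * poissonSq a (bshift a ((bshift a)^[l] G)) ≤
        l * poissonSq a ((bshift a)^[l] G) := by
      refine mul_le_mul_of_nonneg_left ?_ (by positivity)
      rw [h2]; have := sq_nonneg ‖(bshift a)^[l] G a‖; linarith
    push_cast
    linarith

lemma blaschkeCoeff_zero (h : Admissible R a) (hG : DifferentiableOn ℂ G (ball 0 R)) :
    blaschkeCoeff a 0 G = G a := by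
  rw [blaschkeCoeff, ← cavg_poissonKernel_mul h hG]; simp

lemma blaschkeCoeff_succ (h : Admissible R a) (hG : DifferentiableOn ℂ G (ball 0 R)) (l : ℕ) :
    blaschkeCoeff a (l + 1) G = blaschkeCoeff a l (bshift a G) := by
  have hB := differentiableOn_bshift h hG
  have hBc := continuousOn_sphere h.one_lt hB
  have hPc := continuousOn_ofReal_poissonKernel h.norm_lt
  have hb := continuousOn_blaschke h
  have hbc := continuousOn_conj hb
  have key : ∀ z ∈ sphere (0 : ℂ) 1,
      (poissonKernel 0 a z : ℂ) * (G z * conj (blaschke a z) ^ (l + 1)) =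
      (poissonKernel 0 a z : ℂ) * (bshift a G z * conj (blaschke a z) ^ l) +
      G a * conj ((poissonKernel 0 a z : ℂ) * blaschke a z ^ (l + 1)) := by
    intro z hz
    have e2 := blaschke_mul_conj h hz
    rw [eq_add_blaschke_mul_bshift h G (sphere_subset_ball h.one_lt hz), map_mul, map_pow,
      Complex.conj_ofReal]
    linear_combination (poissonKernel 0 a z * bshift a G z * conj (blaschke a z) ^ l) * e2
  have h2 : cavg (fun z => (poissonKernel 0 a z : ℂ) * blaschke a z ^ (l + 1)) = 0 := by
    rw [cavg_poissonKernel_mul h (G := fun z => blaschke a z ^ (l + 1))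
      ((differentiableOn_blaschke h).pow _), blaschke_self]; simp
  have hc1 : ContinuousOn (fun z => conj ((poissonKernel 0 a z : ℂ) * blaschke a z ^ (l + 1)))
    (sphere 0 1) := continuousOn_conj (by fun_prop)
  rw [blaschkeCoeff, cavg_congr key, cavg_add (by fun_prop) (by fun_prop), cavg_const_mul,
    cavg_conj, h2]
  simp [blaschkeCoeff]

lemma blaschkeCoeff_eq (h : Admissible R a) (hG : DifferentiableOn ℂ G (ball 0 R)) (l : ℕ) :
    blaschkeCoeff a l G = (bshift a)^[l] G a := by
  induction l generalizing G with
  | zero => exact blaschkeCoeff_zero h hG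
  | succ l ih =>
    rw [blaschkeCoeff_succ h hG, ih (differentiableOn_bshift h hG), Function.iterate_succ_apply]

/-- The Dirichlet inner product is Hermitian. -/
lemma dirInner_conj_symm (hR : 1 < R) (hG : DifferentiableOn ℂ G (ball 0 R))
    (hH : DifferentiableOn ℂ H (ball 0 R)) : conj (dirInner G H) = dirInner H G := by
  have hGc := continuousOn_sphere hR hG
  have hHc := continuousOn_sphere hR hH
  have hGd := continuousOn_deriv hR hG
  have hHd := continuousOn_deriv hR hH
  have c1 := continuousOn_conj hGc
  have c2 := continuousOn_conj hHc
  have c3 := continuousOn_conj hGd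
  have c4 : ContinuousOn (fun z => conj (z * deriv G z * conj (H z))) (sphere 0 1) :=
    continuousOn_conj (by fun_prop)
  rw [dirInner, ← cavg_conj, dirInner, ← sub_eq_zero, ← cavg_sub c4 (by fun_prop)]
  have hm : ∀ θ, circleMap 0 1 θ ∈ sphere (0 : ℂ) 1 := fun θ =>
    circleMap_mem_sphere 0 zero_le_one θ
  have hd : ∀ θ : ℝ, HasDerivAt (fun θ : ℝ => H (circleMap 0 1 θ) * conj (G (circleMap 0 1 θ)))
      (-Complex.I * ((fun z => conj (z * deriv G z * conj (H z)) - z * deriv H z * conj (G z))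
        (circleMap 0 1 θ))) θ := by
    intro θ
    have h0 := hasDerivAt_circleMap 0 1 θ
    have h1 := (hasDerivAt_of_mem hG (sphere_subset_ball hR (hm θ))).comp θ h0
    have h2 := (hasDerivAt_of_mem hH (sphere_subset_ball hR (hm θ))).comp θ h0
    have h3 : HasDerivAt (fun θ : ℝ => conj (G (circleMap 0 1 θ))) _ θ := h1.star
    refine (h2.mul h3).congr_deriv ?_
    simp only [Function.comp_apply, map_mul, Complex.conj_I, RCLike.star_def,
      Complex.conj_conj]
    ring
  have hcont : Continuous fun θ : ℝ => (fun z => conj (z * deriv G z * conj (H z)) -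
      z * deriv H z * conj (G z)) (circleMap 0 1 θ) := by
    have c5 : ContinuousOn (fun z => conj (z * deriv G z * conj (H z)) -
      z * deriv H z * conj (G z)) (sphere 0 1) := by fun_prop
    exact c5.comp_continuous (continuous_circleMap 0 1) hm
  have := intervalIntegral.integral_eq_sub_of_hasDerivAt (a := 0) (b := 2 * Real.pi)
    (fun θ _ => hd θ) ((continuous_const.mul hcont).intervalIntegrable _ _)
  have hper : circleMap 0 1 (2 * Real.pi) = circleMap 0 1 0 := by simp [circleMap]
  rw [intervalIntegral.integral_const_mul, hper, sub_self] at this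
  have h0 := (mul_eq_zero.mp this).resolve_left (by simp)
  rw [cavg, Real.circleAverage_def, h0, smul_zero]

/-- Pairing with a power of a Blaschke factor. -/
lemma dirInner_blaschke_pow (h : Admissible R a) (l : ℕ) (H : ℂ → ℂ) :
    dirInner (fun z => blaschke a z ^ l) H =
      l * cavg (fun z => (poissonKernel 0 a z : ℂ) * (blaschke a z ^ l * conj (H z))) := by
  rw [dirInner, ← cavg_const_mul]
  refine cavg_congr fun z hz => ?_
  have h1 :=
    (hasDerivAt_of_mem (differentiableOn_blaschke h) (sphere_subset_ball h.one_lt hz)).pow l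
  have h2 : deriv (fun z => blaschke a z ^ l) z = _ := h1.deriv
  rw [h2]
  have e1 := mul_deriv_blaschke h hz
  rcases l with _ | l
  · simp
  · simp only [Nat.add_sub_cancel]
    linear_combination ((l + 1 : ℕ) : ℂ) * blaschke a z ^ l * conj (H z) * e1

lemma dirInner_blaschke_pow_eq (h : Admissible R a) (l : ℕ) (H : ℂ → ℂ) :
    dirInner (fun z => blaschke a z ^ l) H = l * conj (blaschkeCoeff a l H) := by
  rw [dirInner_blaschke_pow h, blaschkeCoeff, ← cavg_conj]
  congr 1
  refine cavg_congr fun z _ => ?_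
  simp only [map_mul, map_pow, Complex.conj_conj, Complex.conj_ofReal]
  ring

lemma blaschkeCoeff_pow (h : Admissible R a) (l m : ℕ) :
    blaschkeCoeff a l (fun z => blaschke a z ^ m) = if l = m then 1 else 0 := by
  have hd := differentiableOn_blaschke h
  have hle : ∀ k : ℕ, cavg (fun z => (poissonKernel 0 a z : ℂ) * blaschke a z ^ k) =
      if k = 0 then 1 else 0 := by
    intro k
    rw [cavg_poissonKernel_mul h (G := fun z => blaschke a z ^ k) (hd.pow _), blaschke_self,
      zero_pow_eq]
  rcases le_total l m with hlm | hlm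
  · obtain ⟨k, rfl⟩ := Nat.exists_eq_add_of_le hlm
    have : blaschkeCoeff a l (fun z => blaschke a z ^ (l + k)) =
        cavg (fun z => (poissonKernel 0 a z : ℂ) * blaschke a z ^ k) := by
      unfold blaschkeCoeff
      refine cavg_congr fun z hz => ?_
      beta_reduce
      rw [pow_add, mul_right_comm, ← mul_pow, blaschke_mul_conj h hz]; simp
    rw [this, hle]; simp
  · obtain ⟨k, rfl⟩ := Nat.exists_eq_add_of_le hlm
    have : blaschkeCoeff a (m + k) (fun z => blaschke a z ^ m) =
        cavg (fun z => conj ((poissonKernel 0 a z : ℂ) * blaschke a z ^ k)) := by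
      unfold blaschkeCoeff
      refine cavg_congr fun z hz => ?_
      beta_reduce
      rw [pow_add, ← mul_assoc (blaschke a z ^ m), ← mul_pow, blaschke_mul_conj h hz]; simp
    rw [this, cavg_conj, hle]; simp

end Dirichlet

section Green
variable {R : ℝ} {F : ℂ → ℂ} {V : ℂ → ℝ}

/-- Polar coordinates, as a map on the whole plane. -/
def polar (x : ℝ × ℝ) : ℂ := x.1 * Complex.exp (x.2 * Complex.I)

lemma differentiable_polar : Differentiable ℝ polar := by
  have h : ContDiff ℝ 1 polar := by
    unfold polar
    exact ((Complex.ofRealCLM.contDiff).comp contDiff_fst).mul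
      (((Complex.ofRealCLM.contDiff.comp contDiff_snd).mul contDiff_const).cexp)
  exact h.differentiable one_ne_zero

lemma norm_polar (x : ℝ × ℝ) : ‖polar x‖ = |x.1| := by
  simp [polar, Complex.norm_exp_ofReal_mul_I]

lemma hasDerivAt_polar_fst (r θ : ℝ) :
    HasDerivAt (fun r => polar (r, θ)) (Complex.exp (θ * Complex.I)) r := by
  simpa [polar] using
    (Complex.ofRealCLM.hasDerivAt (x := r)).mul_const (Complex.exp (θ * Complex.I))

lemma hasDerivAt_exp_mul_I (θ : ℝ) :
    HasDerivAt (fun θ : ℝ => Complex.exp (θ * Complex.I))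
      (Complex.I * Complex.exp (θ * Complex.I)) θ := by
  have := ((Complex.ofRealCLM.hasDerivAt (x := θ)).mul_const Complex.I).cexp
  refine this.congr_deriv ?_
  simp [mul_comm]

lemma hasDerivAt_polar_snd (r θ : ℝ) :
    HasDerivAt (fun θ => polar (r, θ)) (Complex.I * polar (r, θ)) θ := by
  refine ((hasDerivAt_exp_mul_I θ).const_mul (r : ℂ)).congr_deriv ?_
  simp only [polar]; ring

lemma fderiv_apply_conj {z w c : ℂ} (L : ℂ →L[ℝ] ℝ) (r : ℝ) (hc : c * conj c = 1)
    (hz : z = r * c) :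
    L c * (z * w).re - L (Complex.I * z) * (w * c).im = r * L (conj w) := by
  have h1 : conj w = (w * c).re • c - (w * c).im • (Complex.I * c) := by
    have : conj w = conj (w * c) * c := by
      rw [map_mul, mul_assoc, mul_comm (conj c), hc, mul_one]
    rw [this]
    simp only [Complex.real_smul]
    apply Complex.ext <;> simp <;> ring
  have h2 : Complex.I * z = r • (Complex.I * c) := by rw [hz, Complex.real_smul]; ring
  have h3 : (z * w).re = r * (w * c).re := by
    rw [hz, mul_assoc, mul_comm c w, Complex.re_ofReal_mul]
  rw [h1, h2, h3, map_sub, map_smul, map_smul, map_smul]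
  simp only [smul_eq_mul]; ring

/-- Green's formula on the unit disk in polar coordinates, for a harmonic function that is the
real part of a holomorphic one. -/
lemma integral_polar_fderiv (hR : 1 < R) (hF : DifferentiableOn ℂ F (ball 0 R))
    (hV : ContDiffOn ℝ 1 V (ball 0 R)) :
    ∫ x in Icc ((0 : ℝ), -Real.pi) (1, Real.pi),
      x.1 * fderiv ℝ V (polar x) (conj (deriv F (polar x))) =
    ∫ θ in -Real.pi..Real.pi, V (polar (1, θ)) * (polar (1, θ) * deriv F (polar (1, θ))).re := by
  have hF' := hF.deriv isOpen_ball
  have hmem : ∀ x ∈ Icc ((0 : ℝ), -Real.pi) (1, Real.pi), polar x ∈ ball (0 : ℂ) R := by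
    intro x hx
    have h1 := hx.1.1; have h2 := hx.2.1
    simp only at h1 h2
    rw [mem_ball_zero_iff, norm_polar, abs_of_nonneg h1]; linarith
  have hmem' : ∀ x ∈ Ioo (0 : ℝ) 1 ×ˢ Ioo (-Real.pi) Real.pi, polar x ∈ ball (0 : ℂ) R :=
    fun x hx => hmem x ⟨⟨hx.1.1.le, hx.2.1.le⟩, ⟨hx.1.2.le, hx.2.2.le⟩⟩
  set f : ℝ × ℝ → ℝ := fun x => V (polar x) * (polar x * deriv F (polar x)).re with hf
  set g : ℝ × ℝ → ℝ := fun x =>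
    -(V (polar x) * (deriv F (polar x) * Complex.exp (x.2 * Complex.I)).im) with hg
  have hVd : ∀ z ∈ ball (0 : ℂ) R, DifferentiableAt ℝ V z := fun z hz =>
    (hV.differentiableOn one_ne_zero).differentiableAt (isOpen_ball.mem_nhds hz)
  have hFd : ∀ z ∈ ball (0 : ℂ) R, DifferentiableAt ℝ (deriv F) z := fun z hz =>
    (hF'.differentiableAt (isOpen_ball.mem_nhds hz)).restrictScalars ℝ
  have hpd := differentiable_polar
  have hexp : Differentiable ℝ fun x : ℝ × ℝ => Complex.exp (x.2 * Complex.I) := by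
    have h : ContDiff ℝ 1 fun x : ℝ × ℝ => Complex.exp (x.2 * Complex.I) :=
      ((Complex.ofRealCLM.contDiff.comp contDiff_snd).mul contDiff_const).cexp
    exact h.differentiable one_ne_zero
  have hfd : ∀ x, polar x ∈ ball (0 : ℂ) R → DifferentiableAt ℝ f x := fun x hx =>
    ((hVd _ hx).comp x (hpd x)).mul (Complex.reCLM.differentiableAt.comp x
      ((hpd x).mul ((hFd _ hx).comp x (hpd x))))
  have hgd : ∀ x, polar x ∈ ball (0 : ℂ) R → DifferentiableAt ℝ g x := fun x hx =>
    (((hVd _ hx).comp x (hpd x)).mul (Complex.imCLM.differentiableAt.comp x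
      (((hFd _ hx).comp x (hpd x)).mul (hexp x)))).neg
  have key : ∀ x, polar x ∈ ball (0 : ℂ) R → fderiv ℝ f x (1, 0) + fderiv ℝ g x (0, 1) =
      x.1 * fderiv ℝ V (polar x) (conj (deriv F (polar x))) := by
    rintro ⟨r, θ⟩ hx
    have hc : Complex.exp (θ * Complex.I) * conj (Complex.exp (θ * Complex.I)) = 1 := by
      rw [Complex.mul_conj, Complex.normSq_eq_norm_sq, Complex.norm_exp_ofReal_mul_I]; simp
    have hF2 : HasDerivAt (deriv F) (deriv (deriv F) (polar (r, θ))) (polar (r, θ)) :=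
      (hF'.differentiableAt (isOpen_ball.mem_nhds hx)).hasDerivAt
    have f1 : HasDerivAt (fun r => f (r, θ)) (fderiv ℝ f (r, θ) (1, 0)) r :=
      HasFDerivAt.comp_hasDerivAt (l := f) (f := fun r => (r, θ)) r (hfd _ hx).hasFDerivAt
        ((hasDerivAt_id r).prodMk (hasDerivAt_const r θ))
    have g1 : HasDerivAt (fun θ => g (r, θ)) (fderiv ℝ g (r, θ) (0, 1)) θ :=
      HasFDerivAt.comp_hasDerivAt (l := g) (f := fun θ => (r, θ)) θ (hgd _ hx).hasFDerivAt
        ((hasDerivAt_const θ r).prodMk (hasDerivAt_id θ))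
    have v1 := (hVd _ hx).hasFDerivAt.comp_hasDerivAt r (hasDerivAt_polar_fst r θ)
    have v2 := (hVd _ hx).hasFDerivAt.comp_hasDerivAt θ (hasDerivAt_polar_snd r θ)
    have w1 := HasDerivAt.comp r (h₂ := deriv F) hF2 (hasDerivAt_polar_fst r θ)
    have w2 := HasDerivAt.comp θ (h₂ := deriv F) hF2 (hasDerivAt_polar_snd r θ)
    have p1 := Complex.reCLM.hasFDerivAt.comp_hasDerivAt r ((hasDerivAt_polar_fst r θ).mul w1)
    have p2 := Complex.imCLM.hasFDerivAt.comp_hasDerivAt θ (w2.mul (hasDerivAt_exp_mul_I θ))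
    rw [f1.unique (v1.mul p1), g1.unique ((v2.mul p2).neg),
      ← fderiv_apply_conj (z := polar (r, θ)) (fderiv ℝ V (polar (r, θ))) r hc rfl]
    simp only [Function.comp_apply, Pi.mul_apply, Complex.reCLM_apply, Complex.imCLM_apply]
    have e1 : (deriv (deriv F) (polar (r, θ)) * (Complex.I * polar (r, θ)) *
          Complex.exp (θ * Complex.I) +
        deriv F (polar (r, θ)) * (Complex.I * Complex.exp (θ * Complex.I))).im =
        (Complex.exp (θ * Complex.I) * deriv F (polar (r, θ)) +
          polar (r, θ) * (deriv (deriv F) (polar (r, θ)) * Complex.exp (θ * Complex.I))).re := by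
      rw [← Complex.I_mul_im]
      congr 1; ring
    rw [e1]; ring
  have hcont : ContinuousOn (fun x : ℝ × ℝ =>
      x.1 * fderiv ℝ V (polar x) (conj (deriv F (polar x)))) (Icc (0, -Real.pi) (1, Real.pi)) := by
    have h1 : ContinuousOn (fun x => fderiv ℝ V (polar x)) (Icc ((0 : ℝ), -Real.pi) (1, Real.pi)) :=
      (hV.continuousOn_fderiv_of_isOpen isOpen_ball le_rfl).comp
        differentiable_polar.continuous.continuousOn hmem
    have h2 : ContinuousOn (fun x => deriv F (polar x)) (Icc ((0 : ℝ), -Real.pi) (1, Real.pi)) :=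
      hF'.continuousOn.comp differentiable_polar.continuous.continuousOn hmem
    exact continuous_fst.continuousOn.mul
      (h1.clm_apply (Complex.continuous_conj.comp_continuousOn h2))
  have hint : IntegrableOn (fun x => fderiv ℝ f x (1, 0) + fderiv ℝ g x (0, 1))
      (Icc (0, -Real.pi) (1, Real.pi)) :=
    (hcont.integrableOn_compact isCompact_Icc).congr_fun (fun x hx => (key x (hmem x hx)).symm)
      measurableSet_Icc
  have hle : ((0 : ℝ), -Real.pi) ≤ (1, Real.pi) :=
    ⟨zero_le_one, by simpa using Real.pi_pos.le⟩
  have main := integral_divergence_prod_Icc_of_hasFDerivAt_of_le f g (fderiv ℝ f) (fderiv ℝ g)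
    (0, -Real.pi) (1, Real.pi) hle
    (fun x hx => (hfd x (hmem x hx)).continuousAt.continuousWithinAt)
    (fun x hx => (hgd x (hmem x hx)).continuousAt.continuousWithinAt)
    (fun x hx => (hfd x (hmem' x hx)).hasFDerivAt)
    (fun x hx => (hgd x (hmem' x hx)).hasFDerivAt) hint
  rw [setIntegral_congr_fun measurableSet_Icc (fun x hx => key x (hmem x hx))] at main
  rw [main]
  have hper : ∀ r : ℝ, g (r, Real.pi) = g (r, -Real.pi) := by
    intro r
    have : Complex.exp ((Real.pi : ℝ) * Complex.I) =
        Complex.exp (((-Real.pi : ℝ) : ℂ) * Complex.I) := by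
      rw [Complex.ofReal_neg, neg_mul, Complex.exp_neg, Complex.exp_pi_mul_I]; norm_num
    simp only [hg, polar, this]
  have h0 : ∀ θ : ℝ, f (0, θ) = 0 := by intro θ; simp [hf, polar]
  simp only [hper, h0, sub_self, zero_add, intervalIntegral.integral_zero, sub_zero]
  rfl

/-- Green's formula on the unit disk, for a harmonic function that is the real part of a
holomorphic one. -/
lemma integral_ball_fderiv (hR : 1 < R) (hF : DifferentiableOn ℂ F (ball 0 R))
    (hV : ContDiffOn ℝ 1 V (ball 0 R)) :
    ∫ z in ball (0 : ℂ) 1, fderiv ℝ V z (conj (deriv F z)) =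
      2 * Real.pi * cavg (fun z => V z * (z * deriv F z).re) := by
  have h1 := integral_polar_fderiv hR hF hV
  have hpol : ∀ x : ℝ × ℝ, Complex.polarCoord.symm x = polar x := by
    intro x
    rw [Complex.polarCoord_symm_apply, polar, Complex.exp_mul_I]
    simp
  have h2 : ∫ θ in -Real.pi..Real.pi, V (polar (1, θ)) * (polar (1, θ) * deriv F (polar (1, θ))).re
      = 2 * Real.pi * cavg (fun z => V z * (z * deriv F z).re) := by
    rw [cavg, Real.circleAverage_eq_integral_add (-Real.pi), smul_eq_mul,
      intervalIntegral.integral_comp_add_right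
        (fun θ => V (circleMap 0 1 θ) * (circleMap 0 1 θ * deriv F (circleMap 0 1 θ)).re),
      mul_inv_cancel_left₀ (by positivity)]
    have : ∀ θ, circleMap 0 1 θ = polar (1, θ) := by intro θ; simp [circleMap, polar]
    simp only [this, zero_add]
    congr 1; ring
  rw [← h2, ← h1, ← integral_indicator measurableSet_ball, ← Complex.integral_comp_polarCoord_symm]
  simp only [hpol]
  have h3 : ∀ x ∈ polarCoord.target, x.1 • (ball (0 : ℂ) 1).indicator
      (fun z => fderiv ℝ V z (conj (deriv F z))) (polar x) =
      (Iio (1 : ℝ) ×ˢ univ).indicator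
        (fun x : ℝ × ℝ => x.1 * fderiv ℝ V (polar x) (conj (deriv F (polar x)))) x := by
    intro x hx
    have hx0 : 0 < x.1 := hx.1
    have : polar x ∈ ball (0 : ℂ) 1 ↔ x ∈ (Iio (1 : ℝ) ×ˢ univ : Set (ℝ × ℝ)) := by
      rw [mem_ball_zero_iff, norm_polar, abs_of_pos hx0]; simp
    by_cases h : polar x ∈ ball (0 : ℂ) 1
    · rw [indicator_of_mem h, indicator_of_mem (this.mp h), smul_eq_mul]
    · rw [indicator_of_notMem h, indicator_of_notMem (fun h' => h (this.mpr h')), smul_zero]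
  rw [setIntegral_congr_fun polarCoord.open_target.measurableSet h3,
    setIntegral_indicator (measurableSet_Iio.prod MeasurableSet.univ)]
  refine setIntegral_congr_set ?_
  have e1 : polarCoord.target ∩ (Iio (1 : ℝ) ×ˢ univ) =
      Ioo (0 : ℝ) 1 ×ˢ Ioo (-Real.pi) Real.pi := by
    rw [polarCoord_target, prod_inter_prod, Ioi_inter_Iio, inter_univ]
  rw [e1, ← Icc_prod_Icc, Measure.volume_eq_prod]
  exact Measure.set_prod_ae_eq Ioo_ae_eq_Icc Ioo_ae_eq_Icc

lemma fderiv_re (hF : DifferentiableOn ℂ F (ball 0 R)) {z : ℂ} (hz : z ∈ ball (0 : ℂ) R) (w : ℂ) :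
    fderiv ℝ (fun z => (F z).re) z w = (deriv F z * w).re := by
  have h1 : HasDerivAt F (deriv F z) z := hasDerivAt_of_mem hF hz
  have h2 := (Complex.reCLM.hasFDerivAt.comp z (h1.hasFDerivAt.restrictScalars ℝ)).fderiv
  have h3 : fderiv ℝ (fun z => (F z).re) z = _ := h2
  rw [h3]
  simp [mul_comm]

lemma contDiffOn_re (hF : DifferentiableOn ℂ F (ball 0 R)) :
    ContDiffOn ℝ 1 (fun z => (F z).re) (ball 0 R) :=
  Complex.reCLM.contDiff.comp_contDiffOn ((hF.contDiffOn isOpen_ball).restrict_scalars ℝ)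

lemma integral_norm_deriv_sq (hR : 1 < R) (hF : DifferentiableOn ℂ F (ball 0 R)) :
    ∫ z in ball (0 : ℂ) 1, ‖deriv F z‖ ^ 2 =
      2 * Real.pi * cavg (fun z => (F z).re * (z * deriv F z).re) := by
  rw [← integral_ball_fderiv hR hF (contDiffOn_re hF)]
  refine setIntegral_congr_fun measurableSet_ball fun z hz => ?_
  rw [fderiv_re hF (ball_subset_ball hR.le hz), Complex.mul_conj, Complex.normSq_eq_norm_sq,
    Complex.ofReal_re]

lemma dirSq_eq_cavg (hR : 1 < R) (hF : DifferentiableOn ℂ F (ball 0 R)) :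
    dirSq F = 2 * cavg (fun z => (F z).re * (z * deriv F z).re) := by
  have c1 := continuousOn_sphere hR hF
  have c2 := continuousOn_deriv hR hF
  have c3 := continuousOn_conj c1
  have hF' := differentiableOn_deriv hF
  have h0 : cavg (fun z => z * deriv F z * F z) = 0 := by
    rw [cavg_eq_apply_zero hR (by fun_prop)]; simp
  have h1 : dirInner F F = cavg (fun z => z * deriv F z * conj (F z) + z * deriv F z * F z) := by
    rw [cavg_add (by fun_prop) (by fun_prop), h0, add_zero, dirInner]
  rw [dirSq, h1, ← cavg_re (by fun_prop), ← cavg_const_mul_real]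
  refine cavg_congr fun z _ => ?_
  simp; ring

lemma dirSq_nonneg (hR : 1 < R) (hF : DifferentiableOn ℂ F (ball 0 R)) : 0 ≤ dirSq F := by
  have h1 := integral_norm_deriv_sq hR hF
  have h2 : 0 ≤ ∫ z in ball (0 : ℂ) 1, ‖deriv F z‖ ^ 2 :=
    setIntegral_nonneg measurableSet_ball fun _ _ => sq_nonneg _
  rw [h1] at h2
  rw [dirSq_eq_cavg hR hF]
  have := nonneg_of_mul_nonneg_right h2 Real.two_pi_pos
  positivity

/-- Lower bound for the Dirichlet energy in terms of boundary values. -/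
lemma le_integral_norm_fderiv_sq (hR : 1 < R) (hF : DifferentiableOn ℂ F (ball 0 R))
    (hV : ContDiffOn ℝ 1 V (ball 0 R)) :
    Real.pi * (4 * cavg (fun z => V z * (z * deriv F z).re) - dirSq F) ≤
      ∫ z in ball (0 : ℂ) 1, ‖fderiv ℝ V z‖ ^ 2 := by
  have c1 : ContinuousOn (fderiv ℝ V) (ball 0 R) :=
    hV.continuousOn_fderiv_of_isOpen isOpen_ball le_rfl
  have c2 : ContinuousOn (deriv F) (ball 0 R) := (differentiableOn_deriv hF).continuousOn
  have c3 := continuousOn_conj c2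
  have int : ∀ f : ℂ → ℝ, ContinuousOn f (ball 0 R) → IntegrableOn f (ball 0 1) := fun f hf =>
    ((hf.mono (closedBall_subset_ball hR)).integrableOn_compact
      (isCompact_closedBall _ _)).mono_set ball_subset_closedBall
  have i1 := int (fun z => ‖fderiv ℝ V z‖ ^ 2) (by fun_prop)
  have i2 := int (fun z => ‖deriv F z‖ ^ 2) (by fun_prop)
  have i3 := int (fun z => fderiv ℝ V z (conj (deriv F z))) (c1.clm_apply c3)
  have e1 := integral_norm_deriv_sq hR hF
  have e2 := integral_ball_fderiv hR hF hV
  have hle : ∫ z in ball (0 : ℂ) 1, (2 * fderiv ℝ V z (conj (deriv F z)) - ‖deriv F z‖ ^ 2) ≤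
      ∫ z in ball (0 : ℂ) 1, ‖fderiv ℝ V z‖ ^ 2 := by
    refine setIntegral_mono_on ((i3.const_mul 2).sub i2) i1 measurableSet_ball fun z _ => ?_
    have h1 := (le_abs_self _).trans ((fderiv ℝ V z).le_opNorm (conj (deriv F z)))
    rw [RCLike.norm_conj] at h1
    nlinarith [sq_nonneg (‖fderiv ℝ V z‖ - ‖deriv F z‖)]
  rw [integral_sub (i3.const_mul 2) i2, integral_const_mul, e1, e2] at hle
  rw [dirSq_eq_cavg hR hF]
  linarith

end Green

section Selberg
variable {R : ℝ} {F G H : ℂ → ℂ}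

lemma dirInner_sub_left (hR : 1 < R) (hF : DifferentiableOn ℂ F (ball 0 R))
    (hG : DifferentiableOn ℂ G (ball 0 R)) (hH : DifferentiableOn ℂ H (ball 0 R)) :
    dirInner (fun z => F z - G z) H = dirInner F H - dirInner G H := by
  have c1 := continuousOn_deriv hR hF
  have c2 := continuousOn_deriv hR hG
  have c3 := continuousOn_conj (continuousOn_sphere hR hH)
  rw [dirInner, dirInner, dirInner, ← cavg_sub (by fun_prop) (by fun_prop)]
  refine cavg_congr fun z hz => ?_
  have hz' := sphere_subset_ball hR hz
  have := ((hasDerivAt_of_mem hF hz').sub (hasDerivAt_of_mem hG hz')).deriv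
  have h2 : deriv (fun z => F z - G z) z = _ := this
  rw [h2]; ring

lemma dirInner_const_mul_left (hR : 1 < R) (hF : DifferentiableOn ℂ F (ball 0 R)) (c : ℂ) :
    dirInner (fun z => c * F z) H = c * dirInner F H := by
  rw [dirInner, dirInner, ← cavg_const_mul]
  refine cavg_congr fun z hz => ?_
  have h2 : deriv (fun z => c * F z) z = _ :=
    ((hasDerivAt_of_mem hF (sphere_subset_ball hR hz)).const_mul c).deriv
  rw [h2]; ring

lemma dirInner_sum_left {ι : Type*} (s : Finset ι) (hR : 1 < R) {f : ι → ℂ → ℂ}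
    (hf : ∀ i, DifferentiableOn ℂ (f i) (ball 0 R)) (hH : DifferentiableOn ℂ H (ball 0 R)) :
    dirInner (fun z => ∑ i ∈ s, f i z) H = ∑ i ∈ s, dirInner (f i) H := by
  have c3 := continuousOn_conj (continuousOn_sphere hR hH)
  have c1 : ∀ i ∈ s, ContinuousOn (fun z => z * deriv (f i) z * conj (H z)) (sphere 0 1) := by
    intro i _
    have := continuousOn_deriv hR (hf i)
    fun_prop
  simp only [dirInner]
  rw [← cavg_sum s c1]
  refine cavg_congr fun z hz => ?_
  have h2 : deriv (fun z => ∑ i ∈ s, f i z) z = _ :=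
    (HasDerivAt.fun_sum fun i _ => hasDerivAt_of_mem (hf i) (sphere_subset_ball hR hz)).deriv
  rw [h2, Finset.mul_sum, Finset.sum_mul]

lemma dirSq_sub_mul (hR : 1 < R) (hF : DifferentiableOn ℂ F (ball 0 R))
    (hG : DifferentiableOn ℂ G (ball 0 R)) (t : ℝ) :
    dirSq (fun z => F z - t * G z) = dirSq F - 2 * t * (dirInner G F).re + t ^ 2 * dirSq G := by
  have hG' : DifferentiableOn ℂ (fun z => (t : ℂ) * G z) (ball 0 R) := by fun_prop
  have hd : DifferentiableOn ℂ (fun z => F z - t * G z) (ball 0 R) := by fun_prop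
  have e1 := dirInner_sub_left hR hF hG' hd
  have e2 := dirInner_const_mul_left (H := fun z => F z - t * G z) hR hG t
  have e3 : ∀ K, DifferentiableOn ℂ K (ball 0 R) → dirInner K (fun z => F z - t * G z) =
      dirInner K F - t * dirInner K G := by
    intro K hK
    rw [← dirInner_conj_symm hR hd hK, dirInner_sub_left hR hF hG' hK,
      dirInner_const_mul_left hR hG, map_sub, map_mul, dirInner_conj_symm hR hF hK,
      dirInner_conj_symm hR hG hK, Complex.conj_ofReal]
  rw [dirSq, e1, e2, e3 F hF, e3 G hG, dirSq, dirSq]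
  have e4 : (dirInner F G).re = (dirInner G F).re := by
    rw [← dirInner_conj_symm hR hF hG, Complex.conj_re]
  simp only [Complex.sub_re, Complex.re_ofReal_mul, e4]
  ring

lemma norm_sq_blaschkeCoeff_le {a : ℂ} (h : Admissible R a)
    (hG : DifferentiableOn ℂ G (ball 0 R)) (l : ℕ) :
    ‖blaschkeCoeff a (l + 1) G‖ ^ 2 ≤ poissonSq a G - ‖G a‖ ^ 2 := by
  have h1 := poissonSq_eq_sum h hG (l + 2)
  have h2 := poissonSq_nonneg h.norm_lt ((bshift a)^[l + 2] G)
  rw [Finset.sum_range_succ, Finset.sum_range_succ', Function.iterate_zero, id,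
    ← blaschkeCoeff_eq h hG (l + 1)] at h1
  have h3 : 0 ≤ ∑ k ∈ Finset.range l, ‖(bshift a)^[k + 1] G a‖ ^ 2 :=
    Finset.sum_nonneg fun _ _ => sq_nonneg _
  linarith

lemma norm_sq_blaschkeCoeff_pow_le {a b : ℂ} (ha : Admissible R a) (hb : Admissible R b)
    (l m : ℕ) {κ : ℝ} (hκ : 1 - ‖blaschke b a‖ ^ 2 ≤ κ) (hκ1 : κ ≤ 1) :
    ‖blaschkeCoeff a (l + 1) (fun z => blaschke b z ^ m)‖ ^ 2 ≤ m * κ := by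
  refine (norm_sq_blaschkeCoeff_le ha ((differentiableOn_blaschke hb).pow m) l).trans ?_
  have h1 : poissonSq a (blaschke b ^ m) = 1 := by
    rw [poissonSq, ← cavg_poissonKernel ha]
    refine cavg_congr fun z hz => ?_
    simp [norm_blaschke hb hz]
  have h2 : 1 + (m : ℝ) * (-κ) ≤ (1 + -κ) ^ m := one_add_mul_le_pow (by linarith) m
  have h3 : (1 + -κ) ^ m ≤ (‖blaschke b a‖ ^ 2) ^ m :=
    pow_le_pow_left₀ (by linarith) (by linarith) m
  have h4 : ‖(blaschke b ^ m) a‖ ^ 2 = (‖blaschke b a‖ ^ 2) ^ m := by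
    rw [Pi.pow_apply, norm_pow]; ring
  rw [h1, h4]
  linarith

variable {ι : Type*} [Fintype ι] {a : ι → ℂ}

/-- A Selberg type inequality for almost orthogonal powers of Blaschke factors. -/
lemma sum_norm_sq_blaschkeCoeff_le (h : ∀ i, Admissible R (a i)) (hR : 1 < R)
    (hF : DifferentiableOn ℂ F (ball 0 R)) (M : ℕ) {κ s : ℝ} (hs : 0 ≤ s)
    (hκ : ∀ i j, i ≠ j → 1 - ‖blaschke (a j) (a i)‖ ^ 2 ≤ κ) (hκ1 : κ ≤ 1) (hκs : M * κ ≤ s ^ 2) :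
    ∑ t : ι × Fin M, ((t.2 : ℝ) + 1) * ‖blaschkeCoeff (a t.1) (t.2 + 1) F‖ ^ 2 ≤
      (1 + M ^ 2 * Fintype.card ι * s) * dirSq F := by
  classical
  set x : ι × Fin M → ℂ := fun t => blaschkeCoeff (a t.1) (t.2 + 1) F with hx
  set φ : ι × Fin M → ℂ → ℂ := fun t z => blaschke (a t.1) z ^ (t.2 + 1 : ℕ) with hφ
  set S := ∑ t : ι × Fin M, ((t.2 : ℝ) + 1) * ‖x t‖ ^ 2 with hS
  set δ := M ^ 2 * Fintype.card ι * s with hδ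
  have hφd : ∀ t, DifferentiableOn ℂ (φ t) (ball 0 R) := fun t =>
    (differentiableOn_blaschke (h t.1)).pow _
  have hφd' : ∀ t, DifferentiableOn ℂ (fun z => x t * φ t z) (ball 0 R) := fun t =>
    (hφd t).const_mul _
  set Y : ℂ → ℂ := fun z => ∑ t, x t * φ t z with hY
  have hYd : DifferentiableOn ℂ Y (ball 0 R) := DifferentiableOn.fun_sum fun t _ => hφd' t
  have hYG : ∀ G, DifferentiableOn ℂ G (ball 0 R) → dirInner Y G = ∑ t : ι × Fin M,
      x t * (((t.2 + 1 : ℕ) : ℂ) * conj (blaschkeCoeff (a t.1) (t.2 + 1) G)) := by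
    intro G hG
    rw [dirInner_sum_left _ hR hφd' hG]
    refine Finset.sum_congr rfl fun t _ => ?_
    rw [dirInner_const_mul_left hR (hφd t), dirInner_blaschke_pow_eq (h t.1)]
  have hYF : (dirInner Y F).re = S := by
    rw [hYG F hF, Complex.re_sum]
    refine Finset.sum_congr rfl fun t _ => ?_
    have : x t * (((t.2 + 1 : ℕ) : ℂ) * conj (x t)) =
        ((((t.2 : ℝ) + 1) * ‖x t‖ ^ 2 : ℝ) : ℂ) := by
      push_cast
      rw [← Complex.mul_conj']; ring
    rw [this, Complex.ofReal_re]
  have hcross : ∀ t u, ‖dirInner (φ t) (φ u) - if t = u then ((t.2 + 1 : ℕ) : ℂ) else 0‖ ≤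
      M * s := by
    rintro ⟨i, l⟩ ⟨j, m⟩
    have hl : ((l : ℕ) + 1 : ℝ) ≤ M := by exact_mod_cast l.2
    have hm : ((m : ℕ) + 1 : ℝ) ≤ M := by exact_mod_cast m.2
    have e := dirInner_blaschke_pow_eq (h i) (l + 1) (φ (j, m))
    change ‖dirInner (fun z => blaschke (a i) z ^ (l + 1 : ℕ)) (φ (j, m)) - _‖ ≤ _
    rw [e]
    by_cases hij : i = j
    · subst hij
      rw [show φ (i, m) = fun z => blaschke (a i) z ^ (m + 1 : ℕ) from rfl, blaschkeCoeff_pow (h i)]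
      have : (0 : ℝ) ≤ M * s := by positivity
      by_cases hlm : l = m
      · subst hlm; simpa using this
      · have h1 : ¬ ((l : ℕ) + 1 = m + 1) := fun h' => hlm (Fin.ext (by omega))
        simp only [h1, if_false, Prod.mk.injEq, hlm, and_false]
        simpa using this
    · have h1 : ‖blaschkeCoeff (a i) (l + 1) (φ (j, m))‖ ^ 2 ≤ ((m + 1 : ℕ) : ℝ) * κ :=
        norm_sq_blaschkeCoeff_pow_le (h i) (h j) l (m + 1) (hκ i j hij) hκ1
      have h2 : ‖blaschkeCoeff (a i) (l + 1) (φ (j, m))‖ ≤ s := by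
        refine abs_le_of_sq_le_sq' (a := ‖blaschkeCoeff (a i) (l + 1) (φ (j, m))‖) ?_ hs |>.2
        have hκ0 : 0 ≤ κ := by
          have := (sq_nonneg _).trans h1
          exact nonneg_of_mul_nonneg_right this (by positivity)
        push_cast at h1
        nlinarith
      simp only [Prod.mk.injEq, hij, false_and, if_false, sub_zero, norm_mul, RCLike.norm_conj,
        Complex.norm_natCast]
      push_cast
      exact mul_le_mul hl h2 (norm_nonneg _) (by positivity)
  have hDY : dirSq Y ≤ (1 + δ) * S := by
    have e1 : dirInner Y Y = ∑ t, ∑ u, x t * conj (x u) * dirInner (φ t) (φ u) := by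
      rw [show dirInner Y Y = dirInner (fun z => ∑ t, x t * φ t z) Y from rfl,
        dirInner_sum_left _ hR hφd' hYd]
      refine Finset.sum_congr rfl fun t _ => ?_
      rw [dirInner_const_mul_left hR (hφd t), ← dirInner_conj_symm hR hYd (hφd t),
        show dirInner Y (φ t) = dirInner (fun z => ∑ t, x t * φ t z) (φ t) from rfl,
        dirInner_sum_left _ hR hφd' (hφd t), map_sum, Finset.mul_sum]
      refine Finset.sum_congr rfl fun u _ => ?_
      rw [dirInner_const_mul_left hR (hφd u), map_mul, dirInner_conj_symm hR (hφd u) (hφd t)]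
      ring
    have e2 : dirInner Y Y = (S : ℂ) + ∑ t, ∑ u, x t * conj (x u) *
        (dirInner (φ t) (φ u) - if t = u then ((t.2 + 1 : ℕ) : ℂ) else 0) := by
      have : (S : ℂ) = ∑ t, ∑ u, x t * conj (x u) * if t = u then ((t.2 + 1 : ℕ) : ℂ) else 0 := by
        simp only [mul_ite, mul_zero, Finset.sum_ite_eq, Finset.mem_univ, if_true,
          Complex.mul_conj']
        rw [hS]; push_cast
        exact Finset.sum_congr rfl fun t _ => by ring
      rw [this, e1, ← Finset.sum_add_distrib]
      refine Finset.sum_congr rfl fun t _ => ?_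
      rw [← Finset.sum_add_distrib]
      exact Finset.sum_congr rfl fun u _ => by ring
    have e3 : ‖∑ t, ∑ u, x t * conj (x u) *
        (dirInner (φ t) (φ u) - if t = u then ((t.2 + 1 : ℕ) : ℂ) else 0)‖ ≤
        (∑ t, ‖x t‖) ^ 2 * (M * s) := by
      rw [sq, Finset.sum_mul_sum, Finset.sum_mul]
      refine (norm_sum_le _ _).trans (Finset.sum_le_sum fun t _ => ?_)
      rw [Finset.sum_mul]
      refine (norm_sum_le _ _).trans (Finset.sum_le_sum fun u _ => ?_)
      rw [norm_mul, norm_mul, RCLike.norm_conj]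
      exact mul_le_mul_of_nonneg_left (hcross t u) (by positivity)
    have e4 : (∑ t, ‖x t‖) ^ 2 ≤ (Fintype.card ι * M) * ∑ t, ‖x t‖ ^ 2 := by
      have := sq_sum_le_card_mul_sum_sq (s := (Finset.univ : Finset (ι × Fin M)))
        (f := fun t => ‖x t‖)
      simpa using this
    have e5 : ∑ t, ‖x t‖ ^ 2 ≤ S := Finset.sum_le_sum fun t _ => by
      nlinarith [sq_nonneg ‖x t‖, (Nat.cast_nonneg (t.2 : ℕ) : (0 : ℝ) ≤ _)]
    have e6 : dirSq Y ≤ S + (∑ t, ‖x t‖) ^ 2 * (M * s) := by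
      rw [dirSq, e2, Complex.add_re, Complex.ofReal_re]
      linarith [(Complex.re_le_norm _).trans e3]
    have e7 : (∑ t, ‖x t‖) ^ 2 * (M * s) ≤ (Fintype.card ι * M) * S * (M * s) :=
      mul_le_mul_of_nonneg_right (e4.trans (mul_le_mul_of_nonneg_left e5 (by positivity)))
        (by positivity)
    rw [hδ]; linarith
  have hδ0 : 0 < 1 + δ := by positivity
  have hpos := dirSq_nonneg hR (F := fun z => F z - (((1 + δ)⁻¹ : ℝ) : ℂ) * Y z) (by fun_prop)
  rw [dirSq_sub_mul hR hF hYd, hYF] at hpos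
  have : ((1 + δ)⁻¹) ^ 2 * dirSq Y ≤ ((1 + δ)⁻¹) ^ 2 * ((1 + δ) * S) :=
    mul_le_mul_of_nonneg_left hDY (by positivity)
  have e8 : ((1 + δ)⁻¹) ^ 2 * ((1 + δ) * S) = (1 + δ)⁻¹ * S := by field_simp
  have e9 : (1 + δ)⁻¹ * S ≤ dirSq F := by linarith
  rwa [inv_mul_le_iff₀ hδ0] at e9

lemma sum_poissonSq_sub_le (h : ∀ i, Admissible R (a i)) (hR : 1 < R)
    (hF : DifferentiableOn ℂ F (ball 0 R)) (M : ℕ) {κ s : ℝ} (hs : 0 ≤ s)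
    (hκ : ∀ i j, i ≠ j → 1 - ‖blaschke (a j) (a i)‖ ^ 2 ≤ κ) (hκ1 : κ ≤ 1) (hκs : M * κ ≤ s ^ 2)
    {w : ι → ℝ} {L : ι → ℕ} (hw0 : ∀ i, 0 ≤ w i) (hwL : ∀ i, w i ≤ L i)
    (hL : ∀ i, ∀ l < L i, l ≠ 0 → blaschkeCoeff (a i) l F = 0) :
    ∑ i, w i * (poissonSq (a i) F - ‖F (a i)‖ ^ 2) ≤
      (1 + M ^ 2 * Fintype.card ι * s + (∑ i, w i) / (M + 1)) * dirSq F := by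
  have h1 := sum_norm_sq_blaschkeCoeff_le h hR hF M hs hκ hκ1 hκs
  have h2 : ∀ i, w i * (poissonSq (a i) F - ‖F (a i)‖ ^ 2) ≤
      (∑ l : Fin M, ((l : ℝ) + 1) * ‖blaschkeCoeff (a i) (l + 1) F‖ ^ 2) +
        w i * (dirSq F / (M + 1)) := by
    intro i
    have e1 := poissonSq_eq_sum (h i) hF (M + 1)
    have e2 := mul_poissonSq_iterate_le (h i) hF (M + 1)
    have e3 := dirSq_nonneg hR (differentiableOn_bshift_iterate (h i) hF (M + 1))
    have e4 : poissonSq (a i) ((bshift (a i))^[M + 1] F) ≤ dirSq F / (M + 1) := by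
      rw [le_div_iff₀ (by positivity)]
      push_cast at e2; linarith
    rw [Finset.sum_range_succ', Function.iterate_zero, id] at e1
    have e5 : w i * ∑ l ∈ Finset.range M, ‖(bshift (a i))^[l + 1] F (a i)‖ ^ 2 ≤
        ∑ l : Fin M, ((l : ℝ) + 1) * ‖blaschkeCoeff (a i) (l + 1) F‖ ^ 2 := by
      rw [Fin.sum_univ_eq_sum_range
        (fun l => ((l : ℝ) + 1) * ‖blaschkeCoeff (a i) (l + 1) F‖ ^ 2) M, Finset.mul_sum]
      refine Finset.sum_le_sum fun l _ => ?_
      rw [← blaschkeCoeff_eq (h i) hF]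
      by_cases hl : l + 1 < L i
      · simp [hL i _ hl]
      · refine mul_le_mul_of_nonneg_right ((hwL i).trans ?_) (sq_nonneg _)
        exact_mod_cast not_lt.mp hl
    have e6 := mul_le_mul_of_nonneg_left e4 (hw0 i)
    have e7 : poissonSq (a i) F - ‖F (a i)‖ ^ 2 =
        ∑ l ∈ Finset.range M, ‖(bshift (a i))^[l + 1] F (a i)‖ ^ 2 +
          poissonSq (a i) ((bshift (a i))^[M + 1] F) := by linarith
    rw [e7, mul_add]
    exact add_le_add e5 e6
  refine (Finset.sum_le_sum fun i _ => h2 i).trans ?_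
  rw [Finset.sum_add_distrib, ← Finset.sum_mul]
  rw [Fintype.sum_prod_type] at h1
  have : (∑ i, w i) * (dirSq F / (M + 1)) = (∑ i, w i) / (M + 1) * dirSq F := by ring
  rw [this, add_mul _ _ (dirSq F)]
  exact add_le_add_left h1 _

end Selberg

section Fourier
variable {V : ℂ → ℝ}

/-- Fourier coefficients of the restriction of `V` to the unit circle. -/
def fcoeff (V : ℂ → ℝ) (n : ℕ) : ℂ := cavg (fun z => (V z : ℂ) * conj z ^ n)

/-- The polynomial whose real part on the unit circle is the `N`-th Fourier partial sum of `V`. -/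
def fpoly (V : ℂ → ℝ) (N : ℕ) (z : ℂ) : ℂ :=
  2 * ∑ n ∈ Finset.range N, fcoeff V n * z ^ n - fcoeff V 0

lemma continuousOn_ofReal {f : ℂ → ℝ} {s : Set ℂ} (hf : ContinuousOn f s) :
    ContinuousOn (fun z => (f z : ℂ)) s := Complex.continuous_ofReal.comp_continuousOn hf

lemma continuousOn_re {f : ℂ → ℂ} {s : Set ℂ} (hf : ContinuousOn f s) :
    ContinuousOn (fun z => (f z).re) s := Complex.continuous_re.comp_continuousOn hf

lemma differentiable_fpoly (N : ℕ) : Differentiable ℂ (fpoly V N) := by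
  unfold fpoly; fun_prop

lemma continuousOn_fpoly (N : ℕ) (s : Set ℂ) : ContinuousOn (fpoly V N) s :=
  (differentiable_fpoly N).continuous.continuousOn

lemma conj_fcoeff_zero : conj (fcoeff V 0) = fcoeff V 0 := by
  simp [fcoeff, ← cavg_conj]

lemma conj_fcoeff (n : ℕ) : conj (fcoeff V n) = cavg (fun z => (V z : ℂ) * z ^ n) := by
  simp [fcoeff, ← cavg_conj]

lemma cavg_pow_mul_conj_pow (l m : ℕ) :
    cavg (fun z : ℂ => z ^ m * conj z ^ l) = if l = m then 1 else 0 := by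
  have h : Admissible 2 0 := ⟨one_lt_two, by simp⟩
  rw [← blaschkeCoeff_pow h, blaschkeCoeff]
  refine cavg_congr fun z hz => ?_
  rw [mem_sphere_zero_iff_norm] at hz
  simp [blaschke_zero, poissonKernel_def, hz]

lemma cavg_fpoly_mul_conj_pow (N l : ℕ) (hl : l < N) :
    cavg (fun z => fpoly V N z * conj z ^ l) =
      2 * fcoeff V l - if l = 0 then fcoeff V 0 else 0 := by
  have c : ContinuousOn (fun z : ℂ => conj z) (sphere 0 1) := Complex.continuous_conj.continuousOn
  have e : ∀ z ∈ sphere (0 : ℂ) 1, fpoly V N z * conj z ^ l =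
      ∑ n ∈ Finset.range N, (2 * fcoeff V n) * (z ^ n * conj z ^ l) -
        fcoeff V 0 * (z ^ 0 * conj z ^ l) := by
    intro z _
    rw [fpoly, sub_mul, Finset.mul_sum, Finset.sum_mul]
    congr 1
    · exact Finset.sum_congr rfl fun n _ => by ring
    · ring
  rw [cavg_congr e, cavg_sub (by fun_prop) (by fun_prop), cavg_sum _ (fun n _ => by fun_prop)]
  simp only [cavg_const_mul, cavg_pow_mul_conj_pow, mul_ite, mul_one, mul_zero, Finset.sum_ite_eq,
    Finset.mem_range, hl, if_true]

lemma blaschkeCoeff_fpoly (N l : ℕ) (hl : l ≠ 0) (hc : fcoeff V l = 0) :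
    blaschkeCoeff 0 l (fpoly V N) = 0 := by
  have c : ContinuousOn (fun z : ℂ => conj z) (sphere 0 1) := Complex.continuous_conj.continuousOn
  have e : ∀ z ∈ sphere (0 : ℂ) 1,
      (poissonKernel 0 0 z : ℂ) * (fpoly V N z * conj (blaschke 0 z) ^ l) =
      ∑ n ∈ Finset.range N, (2 * fcoeff V n) * (z ^ n * conj z ^ l) -
        fcoeff V 0 * (z ^ 0 * conj z ^ l) := by
    intro z hz
    rw [mem_sphere_zero_iff_norm] at hz
    rw [fpoly, sub_mul, Finset.mul_sum, Finset.sum_mul]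
    simp only [poissonKernel_def, sub_zero, hz, blaschke_zero]
    norm_num
    exact Finset.sum_congr rfl fun n _ => by ring
  rw [blaschkeCoeff, cavg_congr e, cavg_sub (by fun_prop) (by fun_prop),
    cavg_sum _ (fun n _ => by fun_prop)]
  simp only [cavg_const_mul, cavg_pow_mul_conj_pow, mul_ite, mul_one, mul_zero, Finset.sum_ite_eq,
    hl, hc, if_false, ite_self, sub_self]

/-- The partial sum of the Fourier series of `V`. -/
def fsum (V : ℂ → ℝ) (N : ℕ) (z : ℂ) : ℝ := (fpoly V N z).re

lemma continuousOn_fsum (N : ℕ) (s : Set ℂ) : ContinuousOn (fsum V N) s :=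
  continuousOn_re (continuousOn_fpoly N s)

lemma cavg_fsum_mul_pow (N n : ℕ) (hn : n < N) :
    cavg (fun z => (fsum V N z : ℂ) * z ^ n) = conj (fcoeff V n) := by
  have c1 := continuousOn_fpoly (V := V) N (sphere 0 1)
  have c2 := continuousOn_conj c1
  have hd := differentiable_fpoly (V := V) N
  have e : ∀ z ∈ sphere (0 : ℂ) 1, (fsum V N z : ℂ) * z ^ n =
      (1 / 2 : ℂ) * (fpoly V N z * z ^ n) + (1 / 2 : ℂ) * conj (fpoly V N z * conj z ^ n) := by
    intro z _
    have := Complex.add_conj (fpoly V N z)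
    simp only [fsum, map_mul, map_pow, Complex.conj_conj]
    push_cast at this
    linear_combination (-1 / 2 * z ^ n) * this
  have c : ContinuousOn (fun z : ℂ => conj z) (sphere 0 1) := Complex.continuous_conj.continuousOn
  have c3 : ContinuousOn (fun z => conj (fpoly V N z * conj z ^ n)) (sphere 0 1) :=
    continuousOn_conj (by fun_prop)
  have h0 : fpoly V N 0 = fcoeff V 0 := by
    have hN : 0 < N := by omega
    simp only [fpoly, zero_pow_eq, mul_ite, mul_one, mul_zero, Finset.sum_ite_eq', Finset.mem_range,
      hN, if_true]
    ring
  rw [cavg_congr e, cavg_add (by fun_prop) (by fun_prop), cavg_const_mul, cavg_const_mul,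
    cavg_conj, cavg_fpoly_mul_conj_pow N n hn,
    cavg_eq_apply_zero one_lt_two (G := fun z => fpoly V N z * z ^ n) (by fun_prop), h0,
    zero_pow_eq]
  rcases eq_or_ne n 0 with rfl | hn0
  · simp only [if_true, map_sub, map_mul, Complex.conj_ofNat, conj_fcoeff_zero]; ring
  · simp only [hn0, if_false, mul_zero, sub_zero, map_mul, Complex.conj_ofNat]; ring

/-- The remainder of the Fourier series is orthogonal to polynomials of low degree. -/
lemma cavg_sub_fsum_mul_re (hV : ContinuousOn V (sphere 0 1)) (N : ℕ) (k : ℕ → ℂ) :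
    cavg (fun z => (V z - fsum V N z) * (∑ n ∈ Finset.range N, k n * z ^ n).re) = 0 := by
  have c1 := continuousOn_ofReal hV
  have c2 := continuousOn_ofReal (continuousOn_fsum (V := V) N (sphere 0 1))
  have e : ∀ z ∈ sphere (0 : ℂ) 1, (V z - fsum V N z) * (∑ n ∈ Finset.range N, k n * z ^ n).re =
      (∑ n ∈ Finset.range N, k n * ((V z : ℂ) * z ^ n - (fsum V N z : ℂ) * z ^ n)).re := by
    intro z _
    rw [← Complex.re_ofReal_mul, Finset.mul_sum]
    congr 1
    refine Finset.sum_congr rfl fun n _ => ?_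
    push_cast; ring
  rw [cavg_congr e, cavg_re (by fun_prop), cavg_sum _ (fun n _ => by fun_prop)]
  have : ∀ n ∈ Finset.range N,
      cavg (fun z => k n * ((V z : ℂ) * z ^ n - (fsum V N z : ℂ) * z ^ n)) = 0 := by
    intro n hn
    rw [cavg_const_mul, cavg_sub (by fun_prop) (by fun_prop),
      cavg_fsum_mul_pow N n (Finset.mem_range.mp hn), conj_fcoeff]
    ring
  rw [Finset.sum_eq_zero this]; rfl

lemma fpoly_eq_sum (N : ℕ) (hN : 0 < N) (z : ℂ) : fpoly V N z =
    ∑ n ∈ Finset.range N, (2 * fcoeff V n - if n = 0 then fcoeff V 0 else 0) * z ^ n := by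
  simp only [sub_mul, Finset.sum_sub_distrib, ite_mul, zero_mul, Finset.sum_ite_eq',
    Finset.mem_range, hN, if_true, fpoly, Finset.mul_sum, pow_zero, mul_one, mul_assoc]

lemma cavg_mul_fsum (hV : ContinuousOn V (sphere 0 1)) (N : ℕ) (hN : 0 < N) :
    cavg (fun z => V z * fsum V N z) = cavg (fun z => fsum V N z ^ 2) := by
  have c2 := continuousOn_fsum (V := V) N (sphere 0 1)
  rw [← sub_eq_zero, ← cavg_sub (by fun_prop) (by fun_prop),
    ← cavg_sub_fsum_mul_re hV N fun n => 2 * fcoeff V n - if n = 0 then fcoeff V 0 else 0]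
  refine cavg_congr fun z _ => ?_
  rw [← fpoly_eq_sum N hN, ← fsum]; ring

lemma cavg_mul_re_mul_deriv_fpoly (hV : ContinuousOn V (sphere 0 1)) (N : ℕ) (hN : 0 < N) :
    cavg (fun z => V z * (z * deriv (fpoly V N) z).re) =
      cavg (fun z => fsum V N z * (z * deriv (fpoly V N) z).re) := by
  have c2 := continuousOn_fsum (V := V) N (sphere 0 1)
  have c3 : ContinuousOn (fun z => (z * deriv (fpoly V N) z).re) (sphere 0 1) := by
    have := continuousOn_deriv one_lt_two (differentiable_fpoly (V := V) N).differentiableOn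
    exact continuousOn_re (by fun_prop)
  rw [← sub_eq_zero, ← cavg_sub (by fun_prop) (by fun_prop),
    ← cavg_sub_fsum_mul_re hV N fun n =>
      n * (2 * fcoeff V n - if n = 0 then fcoeff V 0 else 0)]
  refine cavg_congr fun z _ => ?_
  have : z * deriv (fpoly V N) z = ∑ n ∈ Finset.range N,
      n * (2 * fcoeff V n - if n = 0 then fcoeff V 0 else 0) * z ^ n := by
    rw [show fpoly V N = _ from funext (fpoly_eq_sum N hN)]
    have h := HasDerivAt.fun_sum (u := Finset.range N) fun n _ =>
      (hasDerivAt_pow n z).const_mul (2 * fcoeff V n - if n = 0 then fcoeff V 0 else 0)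
    rw [h.deriv, Finset.mul_sum]
    refine Finset.sum_congr rfl fun n _ => ?_
    rcases n with _ | n
    · simp
    · simp only [Nat.add_sub_cancel]; ring
  rw [this]; ring

/-- Parseval's identity for the real function `V` on the unit circle. -/
lemma hasSum_norm_sq_fcoeff (hV : ContinuousOn V (sphere 0 1)) :
    HasSum (fun n => 2 * ‖fcoeff V n‖ ^ 2) (cavg (fun z => V z ^ 2) + ‖fcoeff V 0‖ ^ 2) := by
  have hm : ∀ θ, circleMap 0 1 θ ∈ sphere (0 : ℂ) 1 := fun θ =>
    circleMap_mem_sphere 0 zero_le_one θ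
  have hc : Continuous fun θ : ℝ => (V (circleMap 0 1 θ) : ℂ) :=
    (continuousOn_ofReal hV).comp_continuous (continuous_circleMap 0 1) hm
  obtain ⟨C, hC⟩ := (isCompact_sphere (0 : ℂ) 1).exists_bound_of_continuousOn
    (continuousOn_ofReal hV)
  have hL2 : MemLp (fun θ : ℝ => (V (circleMap 0 1 θ) : ℂ)) 2
      (volume.restrict (Ioc 0 (2 * Real.pi))) :=
    MemLp.of_bound hc.aestronglyMeasurable C (ae_of_all _ fun θ => hC _ (hm θ))
  have hs := (hasSum_sq_fourierCoeffOn Real.two_pi_pos hL2).nat_add_neg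
  have hpos : ∀ n : ℕ, fourierCoeffOn Real.two_pi_pos
      (fun θ : ℝ => (V (circleMap 0 1 θ) : ℂ)) n = fcoeff V n := by
    intro n
    rw [fourierCoeffOn_eq_integral, fcoeff, cavg, Real.circleAverage_def, sub_zero, one_div]
    congr 1
    refine intervalIntegral.integral_congr fun θ _ => ?_
    simp only [fourier_coe_apply, circleMap_zero, Complex.ofReal_one, one_mul, smul_eq_mul]
    rw [mul_comm, ← Complex.exp_conj, ← Complex.exp_nat_mul]
    congr 2
    have := Complex.ofReal_ne_zero.mpr Real.pi_ne_zero
    simp only [map_mul, Complex.conj_I, Complex.conj_ofReal]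
    push_cast
    field_simp
  have hneg : ∀ n : ℕ, fourierCoeffOn Real.two_pi_pos
      (fun θ : ℝ => (V (circleMap 0 1 θ) : ℂ)) (-n) = conj (fcoeff V n) := by
    intro n
    rw [fourierCoeffOn_eq_integral, conj_fcoeff, cavg, Real.circleAverage_def, sub_zero, one_div]
    congr 1
    refine intervalIntegral.integral_congr fun θ _ => ?_
    simp only [fourier_coe_apply, circleMap_zero, Complex.ofReal_one, one_mul, smul_eq_mul]
    rw [mul_comm, ← Complex.exp_nat_mul]
    congr 2
    have := Complex.ofReal_ne_zero.mpr Real.pi_ne_zero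
    push_cast
    field_simp
  simp only [hpos, hneg, RCLike.norm_conj] at hs
  have h0 := hpos 0
  rw [Nat.cast_zero] at h0
  rw [h0] at hs
  have e : cavg (fun z => V z ^ 2) = (2 * Real.pi - 0)⁻¹ •
      ∫ θ in 0..2 * Real.pi, ‖(V (circleMap 0 1 θ) : ℂ)‖ ^ 2 := by
    simp [cavg, Real.circleAverage_def]
  rw [e]
  simpa only [two_mul] using hs

lemma tendsto_cavg_sub_fsum_sq (hV : ContinuousOn V (sphere 0 1)) :
    Tendsto (fun N => cavg (fun z => (V z - fsum V N z) ^ 2)) atTop (𝓝 0) := by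
  have h1 := (hasSum_norm_sq_fcoeff hV).tendsto_sum_nat
  have h2 := (h1.const_sub (cavg (fun z => V z ^ 2) + ‖fcoeff V 0‖ ^ 2))
  rw [sub_self] at h2
  refine h2.congr' ?_
  filter_upwards [eventually_gt_atTop 0] with N hN
  have c2 := continuousOn_fsum (V := V) N (sphere 0 1)
  have c1 := continuousOn_ofReal hV
  have e1 : ∀ z ∈ sphere (0 : ℂ) 1, (V z - fsum V N z) ^ 2 =
      V z ^ 2 - V z * fsum V N z - (V z * fsum V N z - fsum V N z ^ 2) := by
    intro z _; ring
  have e2 : cavg (fun z => V z * fsum V N z) =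
      ∑ n ∈ Finset.range N, 2 * ‖fcoeff V n‖ ^ 2 - ‖fcoeff V 0‖ ^ 2 := by
    have e3 : ∀ z ∈ sphere (0 : ℂ) 1, V z * fsum V N z =
        (∑ n ∈ Finset.range N, (2 * fcoeff V n - if n = 0 then fcoeff V 0 else 0) *
          ((V z : ℂ) * z ^ n)).re := by
      intro z _
      rw [fsum, fpoly_eq_sum N hN, ← Complex.re_ofReal_mul, Finset.mul_sum]
      congr 1
      exact Finset.sum_congr rfl fun n _ => by ring
    rw [cavg_congr e3, cavg_re (by fun_prop), cavg_sum _ (fun n _ => by fun_prop)]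
    have e4 : ∀ n ∈ Finset.range N,
        cavg (fun z => (2 * fcoeff V n - if n = 0 then fcoeff V 0 else 0) *
          ((V z : ℂ) * z ^ n)) =
        ((2 * ‖fcoeff V n‖ ^ 2 - if n = 0 then ‖fcoeff V 0‖ ^ 2 else 0 : ℝ) : ℂ) := by
      intro n _
      rw [cavg_const_mul, ← conj_fcoeff, sub_mul, mul_assoc, Complex.mul_conj']
      split_ifs with h
      · rw [h, Complex.mul_conj']; push_cast; ring
      · simp
    rw [Finset.sum_congr rfl e4, ← Complex.ofReal_sum, Complex.ofReal_re, Finset.sum_sub_distrib,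
      Finset.sum_ite_eq', if_pos (Finset.mem_range.mpr hN)]
  rw [cavg_congr e1, cavg_sub (by fun_prop) (by fun_prop), cavg_sub (by fun_prop) (by fun_prop),
    cavg_sub (by fun_prop) (by fun_prop), cavg_mul_fsum hV N hN, ← cavg_mul_fsum hV N hN, e2]
  ring

end Fourier

section Limit
variable {R : ℝ} {a : ℂ} {F : ℂ → ℂ} {f g : ℂ → ℝ}

lemma cavg_poissonKernel_mul_re (h : Admissible R a) (hF : DifferentiableOn ℂ F (ball 0 R)) :
    cavg (fun z => poissonKernel 0 a z * (F z).re) = (F a).re := by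
  have c1 := continuousOn_ofReal_poissonKernel h.norm_lt
  have c2 := continuousOn_sphere h.one_lt hF
  rw [← cavg_poissonKernel_mul h hF, ← cavg_re (by fun_prop)]
  exact cavg_congr fun z _ => (Complex.re_ofReal_mul _ _).symm

lemma cavg_poissonKernel_mul_re_sq (h : Admissible R a) (hF : DifferentiableOn ℂ F (ball 0 R)) :
    cavg (fun z => poissonKernel 0 a z * (F z).re ^ 2) =
      1 / 2 * (poissonSq a F - ‖F a‖ ^ 2) +
        cavg (fun z => poissonKernel 0 a z * (F z).re) ^ 2 := by
  have c1 := continuousOn_poissonKernel h.norm_lt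
  have c2 := continuousOn_sphere h.one_lt hF
  have c3 : ContinuousOn (fun z => (F z ^ 2).re) (sphere 0 1) := continuousOn_re (by fun_prop)
  have key : ∀ u : ℂ, u.re ^ 2 = 1 / 2 * ‖u‖ ^ 2 + 1 / 2 * (u ^ 2).re := by
    intro u
    rw [← Complex.normSq_eq_norm_sq, Complex.normSq_apply, sq u, Complex.mul_re]; ring
  have e : ∀ z ∈ sphere (0 : ℂ) 1, poissonKernel 0 a z * (F z).re ^ 2 =
      1 / 2 * (poissonKernel 0 a z * ‖F z‖ ^ 2) + 1 / 2 * (poissonKernel 0 a z * (F z ^ 2).re) := by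
    intro z _; rw [key]; ring
  rw [cavg_congr e, cavg_add (by fun_prop) (by fun_prop), cavg_const_mul_real, cavg_const_mul_real,
    cavg_poissonKernel_mul_re h hF, cavg_poissonKernel_mul_re h (F := fun z => F z ^ 2) (hF.pow 2),
    key (F a), poissonSq]
  ring

/-- Jensen's inequality for the probability density given by the Poisson kernel. -/
lemma sq_cavg_poissonKernel_mul_le (h : Admissible R a) (hg : ContinuousOn g (sphere 0 1)) :
    cavg (fun z => poissonKernel 0 a z * g z) ^ 2 ≤
      cavg (fun z => poissonKernel 0 a z * g z ^ 2) := by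
  have c1 := continuousOn_poissonKernel h.norm_lt
  set c := cavg (fun z => poissonKernel 0 a z * g z) with hc
  have h0 : 0 ≤ cavg (fun z => poissonKernel 0 a z * (g z - c) ^ 2) :=
    cavg_nonneg fun z hz => mul_nonneg (poissonKernel_pos h.norm_lt hz).le (sq_nonneg _)
  have e : ∀ z ∈ sphere (0 : ℂ) 1, poissonKernel 0 a z * (g z - c) ^ 2 =
      poissonKernel 0 a z * g z ^ 2 - (2 * c) * (poissonKernel 0 a z * g z) +
        c ^ 2 * poissonKernel 0 a z := by
    intro z _; ring
  rw [cavg_congr e, cavg_add (by fun_prop) (by fun_prop), cavg_sub (by fun_prop) (by fun_prop),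
    cavg_const_mul_real, cavg_const_mul_real, cavg_poissonKernel h, ← hc] at h0
  linarith

lemma exists_cavg_poissonKernel_mul_le (h : Admissible R a) :
    ∃ C : ℝ, 0 ≤ C ∧ ∀ g : ℂ → ℝ, ContinuousOn g (sphere 0 1) →
      cavg (fun z => poissonKernel 0 a z * g z ^ 2) ≤ C * cavg (fun z => g z ^ 2) := by
  have c1 := continuousOn_poissonKernel h.norm_lt
  obtain ⟨C, hC⟩ := (isCompact_sphere (0 : ℂ) 1).exists_bound_of_continuousOn c1
  have h1 : (1 : ℂ) ∈ sphere (0 : ℂ) 1 := by simp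
  refine ⟨C, (norm_nonneg _).trans (hC 1 h1), fun g hg => ?_⟩
  rw [← cavg_const_mul_real]
  refine cavg_mono (by fun_prop) (by fun_prop) fun z hz => ?_
  exact mul_le_mul_of_nonneg_right ((le_abs_self _).trans (hC z hz)) (sq_nonneg _)

variable {ι : Type*} [Fintype ι] {a : ι → ℂ} {V : ℂ → ℝ}

/-- The weighted trace inequality for functions orthogonal to the low modes. -/
theorem sum_cavg_poissonKernel_mul_sq_le (h : ∀ i, Admissible R (a i)) (hR : 1 < R)
    (hV : ContDiffOn ℝ 1 V (ball 0 R)) (M : ℕ) {κ s : ℝ} (hs : 0 ≤ s)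
    (hκ : ∀ i j, i ≠ j → 1 - ‖blaschke (a j) (a i)‖ ^ 2 ≤ κ) (hκ1 : κ ≤ 1) (hκs : M * κ ≤ s ^ 2)
    {w : ι → ℝ} {L : ι → ℕ} (hw0 : ∀ i, 0 ≤ w i) (hwL : ∀ i, w i ≤ L i)
    (hmean : ∀ i, cavg (fun z => poissonKernel 0 (a i) z * V z) = 0)
    (hL : ∀ i, ∀ l < L i, l ≠ 0 → a i = 0 ∧ fcoeff V l = 0) :
    2 * Real.pi * ∑ i, w i * cavg (fun z => poissonKernel 0 (a i) z * V z ^ 2) ≤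
      (1 + M ^ 2 * Fintype.card ι * s + (∑ i, w i) / (M + 1)) *
        ∫ z in ball (0 : ℂ) 1, ‖fderiv ℝ V z‖ ^ 2 := by
  set A : ℝ := 1 + M ^ 2 * Fintype.card ι * s + (∑ i, w i) / (M + 1) with hA
  set E : ℝ := ∫ z in ball (0 : ℂ) 1, ‖fderiv ℝ V z‖ ^ 2 with hE
  have hA0 : 0 ≤ A := by
    have : 0 ≤ ∑ i, w i := Finset.sum_nonneg fun i _ => hw0 i
    positivity
  have cV : ContinuousOn V (sphere 0 1) := hV.continuousOn.mono (sphere_subset_ball hR)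
  choose C hC0 hC using fun i => exists_cavg_poissonKernel_mul_le (h i)
  set D : ℝ := ∑ i, w i * C i with hD
  set d : ℕ → ℝ := fun N => cavg (fun z => (V z - fsum V N z) ^ 2) with hd
  have cs : ∀ N, ContinuousOn (fsum V N) (sphere 0 1) := fun N => continuousOn_fsum N _
  have hdN : ∀ N, ∑ i, w i * cavg (fun z => poissonKernel 0 (a i) z * (V z - fsum V N z) ^ 2) ≤
      D * d N := by
    intro N
    rw [hD, Finset.sum_mul]
    refine Finset.sum_le_sum fun i _ => ?_
    rw [mul_assoc]
    have := cs N
    exact mul_le_mul_of_nonneg_left (hC i (fun z => V z - fsum V N z) (by fun_prop)) (hw0 i)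
  have hdir : ∀ N, 0 < N → Real.pi * dirSq (fpoly V N) ≤ E := by
    intro N hN
    have hF := (differentiable_fpoly (V := V) N).differentiableOn (s := ball 0 R)
    have h1 := le_integral_norm_fderiv_sq hR hF hV
    rw [cavg_mul_re_mul_deriv_fpoly cV N hN] at h1
    have h2 := dirSq_eq_cavg hR hF
    refine le_trans (le_of_eq ?_) h1
    simp only [fsum]
    rw [h2]; ring
  have hsN : ∀ N, 0 < N → 2 * Real.pi * ∑ i, w i *
      cavg (fun z => poissonKernel 0 (a i) z * fsum V N z ^ 2) ≤
        A * E + 2 * Real.pi * (D * d N) := by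
    intro N hN
    have hF := (differentiable_fpoly (V := V) N).differentiableOn (s := ball 0 R)
    have h1 := sum_poissonSq_sub_le h hR hF M hs hκ hκ1 hκs hw0 hwL (fun i l hl hl0 => by
      obtain ⟨h0, h1⟩ := hL i l hl hl0
      rw [h0]; exact blaschkeCoeff_fpoly N l hl0 h1)
    have h2 : ∑ i, w i * cavg (fun z => poissonKernel 0 (a i) z * fsum V N z ^ 2) ≤
        1 / 2 * ∑ i, w i * (poissonSq (a i) (fpoly V N) - ‖fpoly V N (a i)‖ ^ 2) + D * d N := by
      refine le_trans ?_ (add_le_add_right (hdN N) _)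
      rw [Finset.mul_sum, ← Finset.sum_add_distrib]
      refine Finset.sum_le_sum fun i _ => ?_
      have c1 := continuousOn_poissonKernel (h i).norm_lt
      have c2 := cs N
      have h3 : cavg (fun z => poissonKernel 0 (a i) z * fsum V N z) =
          - cavg (fun z => poissonKernel 0 (a i) z * (V z - fsum V N z)) := by
        simp only [mul_sub]
        rw [cavg_sub (by fun_prop) (by fun_prop), hmean i]; ring
      have h4 := sq_cavg_poissonKernel_mul_le (h i) (g := fun z => V z - fsum V N z) (by fun_prop)
      have h5 := cavg_poissonKernel_mul_re_sq (h i) hF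
      change cavg (fun z => poissonKernel 0 (a i) z * fsum V N z ^ 2) =
        1 / 2 * _ + cavg (fun z => poissonKernel 0 (a i) z * fsum V N z) ^ 2 at h5
      rw [h5, h3, neg_sq]
      have := mul_le_mul_of_nonneg_left h4 (hw0 i)
      linarith
    rw [← hA] at h1
    have h6 := mul_le_mul_of_nonneg_left (hdir N hN) hA0
    have h7 := mul_le_mul_of_nonneg_left h2 Real.two_pi_pos.le
    have h8 := mul_le_mul_of_nonneg_left h1 Real.pi_pos.le
    nlinarith
  have hdlim : Tendsto d atTop (𝓝 0) := tendsto_cavg_sub_fsum_sq cV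
  have hT : ∀ t : ℝ, 0 < t → 2 * Real.pi * ∑ i, w i *
      cavg (fun z => poissonKernel 0 (a i) z * V z ^ 2) ≤ (1 + t) * (A * E) := by
    intro t ht
    have hlim : Tendsto (fun N => (1 + t) * (A * E + 2 * Real.pi * (D * d N)) +
        2 * Real.pi * ((1 + 1 / t) * (D * d N))) atTop (𝓝 ((1 + t) * (A * E))) := by
      have := (((hdlim.const_mul D).const_mul (2 * Real.pi)).const_add (A * E)).const_mul (1 + t)
      have := this.add (((hdlim.const_mul D).const_mul (1 + 1 / t)).const_mul (2 * Real.pi))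
      simpa using this
    refine ge_of_tendsto hlim ?_
    filter_upwards [eventually_gt_atTop 0] with N hN
    have h1 := mul_le_mul_of_nonneg_left (hsN N hN) (by positivity : 0 ≤ 1 + t)
    have h2 := mul_le_mul_of_nonneg_left (hdN N) (by positivity : 0 ≤ 2 * Real.pi * (1 + 1 / t))
    have h3 : ∑ i, w i * cavg (fun z => poissonKernel 0 (a i) z * V z ^ 2) ≤
        (1 + t) * ∑ i, w i * cavg (fun z => poissonKernel 0 (a i) z * fsum V N z ^ 2) +
        (1 + 1 / t) * ∑ i, w i *
          cavg (fun z => poissonKernel 0 (a i) z * (V z - fsum V N z) ^ 2) := by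
      rw [Finset.mul_sum, Finset.mul_sum, ← Finset.sum_add_distrib]
      refine Finset.sum_le_sum fun i _ => ?_
      have c1 := continuousOn_poissonKernel (h i).norm_lt
      have c2 := cs N
      have h4 : cavg (fun z => poissonKernel 0 (a i) z * V z ^ 2) ≤
          (1 + t) * cavg (fun z => poissonKernel 0 (a i) z * fsum V N z ^ 2) +
          (1 + 1 / t) * cavg (fun z => poissonKernel 0 (a i) z * (V z - fsum V N z) ^ 2) := by
        rw [← cavg_const_mul_real, ← cavg_const_mul_real, ← cavg_add (by fun_prop) (by fun_prop)]
        refine cavg_mono (by fun_prop) (by fun_prop) fun z hz => ?_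
        have hP := (poissonKernel_pos (h i).norm_lt hz).le
        have h5 : V z ^ 2 ≤ (1 + t) * fsum V N z ^ 2 + (1 + 1 / t) * (V z - fsum V N z) ^ 2 := by
          have : (1 + t) * fsum V N z ^ 2 + (1 + 1 / t) * (V z - fsum V N z) ^ 2 - V z ^ 2 =
              (t * fsum V N z - (V z - fsum V N z)) ^ 2 / t := by
            field_simp; ring
          have : 0 ≤ (t * fsum V N z - (V z - fsum V N z)) ^ 2 / t := by positivity
          linarith
        have := mul_le_mul_of_nonneg_left h5 hP
        linarith
      have := mul_le_mul_of_nonneg_left h4 (hw0 i)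
      linarith
    have h4 := mul_le_mul_of_nonneg_left h3 Real.two_pi_pos.le
    linarith
  have hlim : Tendsto (fun t : ℝ => (1 + t) * (A * E)) (𝓝[>] 0) (𝓝 (A * E)) := by
    have : Continuous fun t : ℝ => (1 + t) * (A * E) := by fun_prop
    have := (this.tendsto 0).mono_left (nhdsWithin_le_nhds (s := Ioi 0))
    simpa using this
  exact ge_of_tendsto hlim (by filter_upwards [self_mem_nhdsWithin] with t ht using hT t ht)

end Limit

section Separation
variable {S : Finset ℂ}

/-- The origin together with the points of `S` pulled inside the disk. -/
def pts (S : Finset ℂ) (r : ℝ) : Option S → ℂ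
  | none => 0
  | some ζ => r * (ζ : ℂ)

lemma norm_pts_le (hS : ∀ ζ ∈ S, ‖ζ‖ = 1) {r : ℝ} (hr : 0 ≤ r) (i : Option S) :
    ‖pts S r i‖ ≤ r := by
  rcases i with _ | ζ
  · simpa [pts] using hr
  · simp [pts, hS ζ ζ.2, abs_of_nonneg hr]

lemma admissible_pts (hS : ∀ ζ ∈ S, ‖ζ‖ = 1) {r : ℝ} (hr0 : 0 < r) (hr1 : r < 1)
    (i : Option S) : Admissible (1 / r) (pts S r i) := by
  refine ⟨by rw [lt_div_iff₀ hr0]; linarith, ?_⟩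
  rw [mul_one_div, div_le_one hr0]
  exact norm_pts_le hS hr0.le i

lemma tendsto_one_sub_norm_blaschke_sq (hS : ∀ ζ ∈ S, ‖ζ‖ = 1) {i j : Option S} (hij : i ≠ j) :
    Tendsto (fun r : ℝ => 1 - ‖blaschke (pts S r j) (pts S r i)‖ ^ 2) (𝓝 1) (𝓝 0) := by
  have hc : ∀ i : Option S, Continuous fun r : ℝ => pts S r i := by
    intro i
    rcases i with _ | ζ
    · exact continuous_const
    · exact Complex.continuous_ofReal.mul continuous_const
  have key : 1 - conj (pts S 1 j) * pts S 1 i ≠ 0 ∧ ‖blaschke (pts S 1 j) (pts S 1 i)‖ = 1 := by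
    rcases i with _ | ζ <;> rcases j with _ | ξ
    · exact absurd rfl hij
    · simp [pts, blaschke, hS ξ ξ.2]
    · simp [pts, blaschke, hS ζ ζ.2]
    · have hne : (ξ : ℂ) - ζ ≠ 0 := by
        rw [sub_ne_zero]
        exact fun he => hij (congrArg some (Subtype.ext he.symm))
      have h1 : conj (ξ : ℂ) * ξ = 1 := by rw [Complex.conj_mul', hS ξ ξ.2]; simp
      have h2 : 1 - conj (ξ : ℂ) * ζ = conj (ξ : ℂ) * (ξ - ζ) := by rw [mul_sub, h1]
      have h3 : conj (ξ : ℂ) ≠ 0 := left_ne_zero_of_mul_eq_one h1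
      simp only [pts, Complex.ofReal_one, one_mul, blaschke, h2]
      refine ⟨mul_ne_zero h3 hne, ?_⟩
      rw [norm_div, norm_mul, RCLike.norm_conj, hS ξ ξ.2, one_mul, norm_sub_rev]
      exact div_self (norm_ne_zero_iff.mpr hne)
  have hcj := hc j
  have hci := hc i
  have hconj : Continuous fun r : ℝ => conj (pts S r j) := Complex.continuous_conj.comp hcj
  have hb : ContinuousAt (fun r : ℝ => blaschke (pts S r j) (pts S r i)) 1 := by
    unfold blaschke
    exact ContinuousAt.div (by fun_prop) (by fun_prop) key.1
  have h : Tendsto (fun r : ℝ => 1 - ‖blaschke (pts S r j) (pts S r i)‖ ^ 2) (𝓝 1)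
      (𝓝 (1 - ‖blaschke (pts S 1 j) (pts S 1 i)‖ ^ 2)) := (hb.tendsto.norm.pow 2).const_sub 1
  rwa [key.2, one_pow, sub_self] at h

/-- Near the boundary the constant in the weighted trace inequality is close to one. -/
theorem exists_radius_sum_cavg_le (hS : ∀ ζ ∈ S, ‖ζ‖ = 1) {w : Option S → ℝ} {L : Option S → ℕ}
    (hw0 : ∀ i, 0 ≤ w i) (hwL : ∀ i, w i ≤ L i) (hL : ∀ i, 1 < L i → i = none)
    {ε : ℝ} (hε : 0 < ε) :
    ∃ r : ℝ, 0 < r ∧ r < 1 ∧ ∀ V : ℂ → ℝ, ContDiff ℝ 1 V →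
      (∀ i, cavg (fun z => poissonKernel 0 (pts S r i) z * V z) = 0) →
      (∀ l < L none, l ≠ 0 → fcoeff V l = 0) →
      2 * Real.pi * ∑ i, w i * cavg (fun z => poissonKernel 0 (pts S r i) z * V z ^ 2) ≤
        (1 + ε) * ∫ z in ball (0 : ℂ) 1, ‖fderiv ℝ V z‖ ^ 2 := by
  have hW : 0 ≤ ∑ i, w i := Finset.sum_nonneg fun i _ => hw0 i
  obtain ⟨M, hM⟩ := exists_nat_gt ((∑ i, w i) / (ε / 2))
  have hM' : (∑ i, w i) / (M + 1) ≤ ε / 2 := by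
    rw [div_lt_iff₀ (by positivity)] at hM
    rw [div_le_iff₀ (by positivity)]
    nlinarith
  set c : ℝ := M ^ 2 * Fintype.card (Option S) with hc
  have hc0 : 0 ≤ c := by positivity
  set s : ℝ := ε / (2 * (c + 1)) with hs
  have hs0 : 0 < s := by positivity
  have hcs : c * s ≤ ε / 2 := by
    rw [hs, mul_div_assoc', div_le_div_iff₀ (by positivity) two_pos]
    nlinarith
  set κ : ℝ := min 1 (s ^ 2 / (M + 1)) with hκ
  have hκ0 : 0 < κ := lt_min one_pos (by positivity)
  have hκs : M * κ ≤ s ^ 2 := by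
    have h1 : κ ≤ s ^ 2 / (M + 1) := min_le_right _ _
    rw [le_div_iff₀ (by positivity)] at h1
    nlinarith
  have hev : ∀ᶠ r : ℝ in 𝓝[<] 1, ∀ i j : Option S, i ≠ j →
      1 - ‖blaschke (pts S r j) (pts S r i)‖ ^ 2 ≤ κ := by
    refine nhdsWithin_le_nhds (eventually_all.mpr fun i => eventually_all.mpr fun j => ?_)
    by_cases hij : i = j
    · exact Eventually.of_forall fun _ h => absurd hij h
    · filter_upwards [(tendsto_one_sub_norm_blaschke_sq hS hij).eventually_lt_const hκ0]
        with r hr _ using hr.le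
  have hpos : ∀ᶠ r : ℝ in 𝓝[<] 1, 0 < r := nhdsWithin_le_nhds (lt_mem_nhds one_pos)
  have hlt : ∀ᶠ r : ℝ in 𝓝[<] 1, r < 1 := self_mem_nhdsWithin
  obtain ⟨r, hr, hr0, hr1⟩ := (hev.and (hpos.and hlt)).exists
  refine ⟨r, hr0, hr1, fun V hV hmean hcoef => ?_⟩
  have hadm := admissible_pts hS hr0 hr1
  refine (sum_cavg_poissonKernel_mul_sq_le hadm (hadm none).one_lt hV.contDiffOn M hs0.le hr
    (min_le_left _ _) hκs hw0 hwL hmean fun i l hl hl0 => ?_).trans ?_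
  · have hi := hL i (by omega)
    rw [hi] at hl ⊢
    exact ⟨rfl, hcoef l hl hl0⟩
  · refine mul_le_mul_of_nonneg_right (by rw [← hc]; linarith) ?_
    exact integral_nonneg fun z => by positivity

end Separation

section ArcLength

/-- The identification of the complex plane with the Euclidean plane. -/
def toE2 : ℂ ≃ₗᵢ[ℝ] E2 := Complex.orthonormalBasisOneI.repr

@[simp] lemma toE2_apply_zero (z : ℂ) : toE2 z 0 = z.re := by
  exact congrFun (Complex.orthonormalBasisOneI_repr_apply z) 0

@[simp] lemma toE2_apply_one (z : ℂ) : toE2 z 1 = z.im := by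
  exact congrFun (Complex.orthonormalBasisOneI_repr_apply z) 1

lemma image_toE2_sphere : toE2 '' sphere (0 : ℂ) 1 = sphere (0 : E2) 1 := by
  rw [LinearIsometryEquiv.image_sphere, map_zero]

/-- Rotation of the Euclidean plane by a unit complex number. -/
def rot (c : Circle) : E2 ≃ₗᵢ[ℝ] E2 := (toE2.symm.trans (rotation c)).trans toE2

lemma rot_toE2 (c : Circle) (z : ℂ) : rot c (toE2 z) = toE2 (c * z) := by
  simp [rot]

local instance : Fact (0 < 2 * Real.pi) := ⟨Real.two_pi_pos⟩

/-- The parametrization of the unit circle of the Euclidean plane by angle. -/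
def circleParam (t : AddCircle (2 * Real.pi)) : E2 := toE2 (AddCircle.toCircle t)

lemma circleParam_coe (θ : ℝ) : circleParam θ = toE2 (circleMap 0 1 θ) := by
  rw [circleParam, AddCircle.toCircle_apply_mk, div_self Real.two_pi_pos.ne', one_mul,
    Circle.coe_exp, circleMap_zero, Complex.ofReal_one, one_mul]

lemma circleParam_add (s t : AddCircle (2 * Real.pi)) :
    circleParam (s + t) = rot (AddCircle.toCircle s) (circleParam t) := by
  rw [circleParam, AddCircle.toCircle_add, circleParam, rot_toE2]; rfl

lemma measurableEmbedding_circleParam : MeasurableEmbedding circleParam := by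
  have hc : Continuous circleParam :=
    toE2.continuous.comp (continuous_subtype_val.comp AddCircle.continuous_toCircle)
  refine (hc.isClosedEmbedding ?_).measurableEmbedding
  exact toE2.injective.comp
    (Subtype.val_injective.comp (AddCircle.injective_toCircle Real.two_pi_pos.ne'))

lemma range_circleParam : range circleParam = sphere (0 : E2) 1 := by
  have h : range circleParam = range (fun θ : ℝ => toE2 (circleMap 0 1 θ)) := by
    have : (fun θ : ℝ => toE2 (circleMap 0 1 θ)) =
        circleParam ∘ ((↑) : ℝ → AddCircle (2 * Real.pi)) :=
      funext fun θ => (circleParam_coe θ).symm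
    rw [this, range_comp, (QuotientAddGroup.mk_surjective).range_eq, image_univ]
  have h2 : (fun θ : ℝ => toE2 (circleMap 0 1 θ)) = toE2 ∘ circleMap 0 1 := rfl
  rw [h, h2, range_comp, range_circleMap, abs_one, image_toE2_sphere]

lemma hausdorffMeasure_sphere_lt_top : μH[1] (sphere (0 : E2) 1) < ⊤ := by
  have h : sphere (0 : E2) 1 = (fun θ : ℝ => toE2 (circleMap 0 1 θ)) '' Ioc 0 (2 * Real.pi) := by
    have h2 : (fun θ : ℝ => toE2 (circleMap 0 1 θ)) = toE2 ∘ circleMap 0 1 := rfl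
    rw [h2, image_comp, image_circleMap_Ioc, abs_one, image_toE2_sphere]
  have hl : LipschitzWith 1 (fun θ : ℝ => toE2 (circleMap 0 1 θ)) := by
    have := toE2.lipschitz.comp (lipschitzWith_circleMap 0 1)
    rw [one_mul, map_one] at this
    exact this
  rw [h]
  refine (hl.hausdorffMeasure_image_le zero_le_one _).trans_lt ?_
  rw [hausdorffMeasure_real, Real.volume_Ioc]
  simp [ENNReal.mul_lt_top]

lemma hausdorffMeasure_sphere_pos : 0 < μH[1] (sphere (0 : E2) 1) := by
  have hl : LipschitzWith 1 (fun x : E2 => x 0) := by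
    refine LipschitzWith.of_dist_le_mul fun x y => ?_
    rw [NNReal.coe_one, one_mul, dist_eq_norm, dist_eq_norm]
    exact PiLp.norm_apply_le (x - y) 0
  have h := hl.hausdorffMeasure_image_le (d := 1) zero_le_one (sphere (0 : E2) 1)
  have hsub : Icc (-1 : ℝ) 1 ⊆ (fun x : E2 => x 0) '' sphere (0 : E2) 1 := by
    intro t ht
    refine ⟨toE2 (circleMap 0 1 (Real.arccos t)), ?_, ?_⟩
    · rw [← image_toE2_sphere]
      exact mem_image_of_mem _ (circleMap_mem_sphere 0 zero_le_one _)
    · simp [circleMap_zero, Complex.exp_ofReal_mul_I_re, Real.cos_arccos ht.1 ht.2]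
  have h2 := measure_mono (μ := (μH[1] : Measure ℝ)) hsub
  rw [hausdorffMeasure_real, Real.volume_Icc] at h2
  rw [hausdorffMeasure_real] at h
  simp only [ENNReal.coe_one, ENNReal.one_rpow, one_mul] at h
  refine lt_of_lt_of_le ?_ (h2.trans h)
  norm_num

instance : (Measure.comap circleParam μH[1]).IsAddLeftInvariant := by
  refine ⟨fun s => ?_⟩
  ext A hA
  have hm := measurableEmbedding_circleParam
  rw [Measure.map_apply (measurable_const_add s) hA, hm.comap_apply, hm.comap_apply]
  have : circleParam '' A =
      (rot (AddCircle.toCircle s)).toIsometryEquiv ''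
        (circleParam '' ((fun x => s + x) ⁻¹' A)) := by
    rw [image_image]
    ext x
    constructor
    · rintro ⟨t, ht, rfl⟩
      refine ⟨-s + t, by simpa using ht, ?_⟩
      change rot _ (circleParam (-s + t)) = _
      rw [← circleParam_add, add_neg_cancel_left]
    · rintro ⟨t, ht, rfl⟩
      exact ⟨s + t, ht, circleParam_add s t⟩
  rw [this, IsometryEquiv.hausdorffMeasure_image]

lemma comap_circleParam_univ :
    Measure.comap circleParam μH[1] univ = μH[1] (sphere (0 : E2) 1) := by
  rw [measurableEmbedding_circleParam.comap_apply, image_univ, range_circleParam]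

/-- Hausdorff measure on the unit circle is a constant multiple of arc length. -/
theorem exists_lintegral_sphere_eq : ∃ c : ℝ≥0∞, c ≠ 0 ∧ c ≠ ⊤ ∧ ∀ g : ℂ → ℝ,
    ContinuousOn g (sphere 0 1) → (∀ z ∈ sphere (0 : ℂ) 1, 0 ≤ g z) → ∀ G : E2 → ℝ,
    (∀ z ∈ sphere (0 : ℂ) 1, G (toE2 z) = g z) →
    ∫⁻ x in sphere (0 : E2) 1, ENNReal.ofReal (G x) ∂μH[1] =
      c * ENNReal.ofReal (2 * Real.pi * cavg g) := by
  have hm := measurableEmbedding_circleParam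
  set ν : Measure (AddCircle (2 * Real.pi)) := Measure.comap circleParam μH[1] with hν
  have : IsFiniteMeasure ν :=
    ⟨by rw [hν, comap_circleParam_univ]; exact hausdorffMeasure_sphere_lt_top⟩
  have hsmul := Measure.isAddLeftInvariant_eq_smul ν volume
  set c := ν.addHaarScalarFactor volume with hc
  refine ⟨c, ?_, ENNReal.coe_ne_top, fun g hg hg0 G hG => ?_⟩
  · intro h0
    have h1 : ν univ = 0 := by
      rw [hsmul, ENNReal.coe_eq_zero.mp h0]; simp
    rw [hν, comap_circleParam_univ] at h1
    exact hausdorffMeasure_sphere_pos.ne' h1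
  · have hcm : ∀ θ : ℝ, circleMap 0 1 θ ∈ sphere (0 : ℂ) 1 := fun θ =>
      circleMap_mem_sphere 0 zero_le_one θ
    rw [← range_circleParam, ← hm.map_comap, hm.lintegral_map, ← hν, hsmul, lintegral_smul_measure,
      ← AddCircle.lintegral_preimage (2 * Real.pi) 0, zero_add]
    simp only [circleParam_coe, hG _ (hcm _)]
    have hcont : Continuous fun θ : ℝ => g (circleMap 0 1 θ) :=
      hg.comp_continuous (continuous_circleMap 0 1) hcm
    rw [← ofReal_integral_eq_lintegral_ofReal
      ((hcont.intervalIntegrable 0 (2 * Real.pi)).1)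
      (ae_of_all _ fun θ => hg0 _ (hcm θ)), ← intervalIntegral.integral_of_le Real.two_pi_pos.le,
      cavg, Real.circleAverage_def, smul_eq_mul, mul_inv_cancel_left₀ Real.two_pi_pos.ne']
    rfl

end ArcLength

section Domain

lemma norm_sq_toE2 (z : ℂ) : ‖z‖ ^ 2 = z.re ^ 2 + z.im ^ 2 := by
  rw [← Complex.normSq_eq_norm_sq, Complex.normSq_apply]; ring

lemma norm_sq_E2 (x : E2) : ‖x‖ ^ 2 = x 0 ^ 2 + x 1 ^ 2 := by
  obtain ⟨z, rfl⟩ := toE2.surjective x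
  rw [toE2.norm_map, norm_sq_toE2, toE2_apply_zero, toE2_apply_one]

/-- The lower unit semicircle as a graph, frozen outside `[-1/2, 1/2]`. -/
def lowerArc (t : ℝ) : ℝ := -√(1 - (max (-1 / 2) (min t (1 / 2))) ^ 2)

lemma lipschitzWith_lowerArc : LipschitzWith 1 lowerArc := by
  have hl : LipschitzWith 1 (fun t : ℝ => max (-1 / 2) (min t (1 / 2))) :=
    (LipschitzWith.id.min_const (1 / 2)).const_max (-1 / 2)
  refine LipschitzWith.of_dist_le_mul fun s t => ?_
  refine le_trans ?_ (hl.dist_le_mul s t)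
  rw [Real.dist_eq, Real.dist_eq, lowerArc, lowerArc]
  have hb : ∀ t : ℝ, |max (-1 / 2) (min t (1 / 2))| ≤ 1 / 2 := fun t =>
    abs_le.mpr ⟨by rw [← neg_div]; exact le_max_left _ _,
      max_le (by norm_num) (min_le_right _ _)⟩
  have hs := hb s
  have ht := hb t
  set a := max (-1 / 2) (min s (1 / 2))
  set b := max (-1 / 2) (min t (1 / 2))
  have hroot : ∀ u : ℝ, |u| ≤ 1 / 2 → 1 / 2 ≤ √(1 - u ^ 2) := by
    intro u hu
    refine Real.le_sqrt_of_sq_le ?_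
    have := sq_abs u
    nlinarith [abs_nonneg u]
  have ha1 : 0 ≤ 1 - a ^ 2 := by nlinarith [sq_abs a, abs_nonneg a]
  have hb1 : 0 ≤ 1 - b ^ 2 := by nlinarith [sq_abs b, abs_nonneg b]
  have e : (-√(1 - a ^ 2) - -√(1 - b ^ 2)) * (√(1 - a ^ 2) + √(1 - b ^ 2)) = (a - b) * (a + b) := by
    have h1 := Real.sq_sqrt ha1
    have h2 := Real.sq_sqrt hb1
    linear_combination h2 - h1
  have h3 := congrArg abs e
  rw [abs_mul, abs_mul] at h3
  have h4 : 1 ≤ |√(1 - a ^ 2) + √(1 - b ^ 2)| :=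
    le_trans (by linarith [hroot a hs, hroot b ht]) (le_abs_self _)
  have h5 : |a + b| ≤ 1 := (abs_add_le a b).trans (by linarith)
  calc |-√(1 - a ^ 2) - -√(1 - b ^ 2)|
      ≤ |-√(1 - a ^ 2) - -√(1 - b ^ 2)| * |√(1 - a ^ 2) + √(1 - b ^ 2)| :=
        le_mul_of_one_le_right (abs_nonneg _) h4
    _ = |a - b| * |a + b| := h3
    _ ≤ |a - b| := mul_le_of_le_one_right (abs_nonneg _) h5

lemma isLipschitzDomain_ball : IsLipschitzDomain (ball (0 : E2) 1) := by
  refine ⟨isOpen_ball, ⟨⟨0, mem_ball_self one_pos⟩, (convex_ball 0 1).isPreconnected⟩,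
    isBounded_ball, fun x hx => ?_⟩
  rw [frontier_ball _ one_ne_zero, ← image_toE2_sphere] at hx
  obtain ⟨z, hz, rfl⟩ := hx
  obtain ⟨u, rfl⟩ : ∃ u : Circle, (u : ℂ) = z := ⟨⟨z, hz⟩, rfl⟩
  set e := rot (Circle.exp (-(Real.pi / 2)) * u⁻¹) with he
  have hez : e (toE2 u) = toE2 (-Complex.I) := by
    rw [he, rot_toE2, ← Circle.coe_mul, inv_mul_cancel_right, Circle.coe_exp]
    congr 1
    push_cast
    rw [neg_mul, Complex.exp_neg, Complex.exp_pi_div_two_mul_I, Complex.inv_I]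
  have he0 : Continuous fun x => e x 0 :=
    (EuclideanSpace.proj (𝕜 := ℝ) 0).continuous.comp e.continuous
  have he1 : Continuous fun x => e x 1 :=
    (EuclideanSpace.proj (𝕜 := ℝ) 1).continuous.comp e.continuous
  refine ⟨e, 1, lowerArc, {x | |e x 0| < 1 / 2 ∧ e x 1 < 0}, lipschitzWith_lowerArc, ?_, ?_, ?_⟩
  · exact (isOpen_lt he0.abs continuous_const).inter (isOpen_lt he1 continuous_const)
  · simp only [mem_ofPred_eq, hez, toE2_apply_zero, toE2_apply_one]
    norm_num
  · rintro x ⟨hx0, hx1⟩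
    obtain ⟨h1, h2⟩ := abs_lt.mp hx0
    rw [mem_ball_zero_iff, ← e.norm_map x, lowerArc, min_eq_left h2.le,
      max_eq_right (by linarith), neg_lt, Real.lt_sqrt (by linarith),
      ← sq_lt_one_iff₀ (norm_nonneg _), norm_sq_E2, neg_sq, lt_sub_iff_add_lt']

lemma rotBy_eq_rot (θ : ℝ) (x : E2) : rotBy θ x = rot (Circle.exp θ) x := by
  obtain ⟨z, rfl⟩ := toE2.surjective x
  rw [rot_toE2]
  ext i
  fin_cases i
  · simp [rotBy, Circle.coe_exp, Complex.exp_re, Complex.exp_im]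
  · simp [rotBy, Circle.coe_exp, Complex.exp_re, Complex.exp_im]; ring

lemma image_rotBy_ball (θ : ℝ) : rotBy θ '' ball (0 : E2) 1 = ball 0 1 := by
  rw [show rotBy θ = rot (Circle.exp θ) from funext (rotBy_eq_rot θ),
    LinearIsometryEquiv.image_ball, map_zero]

lemma simplyConnectedSpace_ball : SimplyConnectedSpace (ball (0 : E2) 1) := by
  have : ContractibleSpace (ball (0 : E2) 1) :=
    (convex_ball 0 1).contractibleSpace ⟨0, mem_ball_self one_pos⟩
  infer_instance

end Domain

section Weight
variable {S : Finset ℂ} {w : Option S → ℝ} {r : ℝ}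

/-- A superposition of Poisson kernels, as a weight on the plane. -/
def weight (S : Finset ℂ) (w : Option S → ℝ) (r : ℝ) (x : E2) : ℝ :=
  ∑ i, w i * ((1 - ‖pts S r i‖ ^ 2) / ‖toE2.symm x - pts S r i‖ ^ 2)

lemma weight_toE2 {z : ℂ} (hz : z ∈ sphere (0 : ℂ) 1) :
    weight S w r (toE2 z) = ∑ i, w i * poissonKernel 0 (pts S r i) z := by
  rw [mem_sphere_zero_iff_norm] at hz
  simp [weight, poissonKernel_def, hz]

lemma weight_nonneg (hS : ∀ ζ ∈ S, ‖ζ‖ = 1) (hr0 : 0 < r) (hr1 : r < 1) (hw : ∀ i, 0 ≤ w i)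
    (x : E2) : 0 ≤ weight S w r x := by
  refine Finset.sum_nonneg fun i _ => mul_nonneg (hw i) (div_nonneg ?_ (sq_nonneg _))
  have := (admissible_pts hS hr0 hr1 i).norm_lt
  nlinarith [norm_nonneg (pts S r i)]

lemma continuousOn_sum_poissonKernel (hS : ∀ ζ ∈ S, ‖ζ‖ = 1) (hr0 : 0 < r) (hr1 : r < 1) :
    ContinuousOn (fun z => ∑ i, w i * poissonKernel 0 (pts S r i) z) (sphere 0 1) :=
  continuousOn_finsetSum _ fun i _ =>
    continuousOn_const.mul (continuousOn_poissonKernel (admissible_pts hS hr0 hr1 i).norm_lt)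

lemma weight_pos (hS : ∀ ζ ∈ S, ‖ζ‖ = 1) (hr0 : 0 < r) (hr1 : r < 1) (hw : ∀ i, 0 < w i)
    {x : E2} (hx : x ∈ sphere (0 : E2) 1) : 0 < weight S w r x := by
  rw [← image_toE2_sphere] at hx
  obtain ⟨z, hz, rfl⟩ := hx
  rw [weight_toE2 hz]
  exact Finset.sum_pos (fun i _ => mul_pos (hw i)
    (poissonKernel_pos (admissible_pts hS hr0 hr1 i).norm_lt hz)) ⟨none, Finset.mem_univ _⟩

lemma weight_rot (c : Circle) (hc : ∀ ζ, (c : ℂ) * ζ ∈ S ↔ ζ ∈ S)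
    (hw : ∀ i j, w (some i) = w (some j))
    (x : E2) : weight S w r (rot c x) = weight S w r x := by
  obtain ⟨z, rfl⟩ := toE2.surjective x
  have hn : ∀ u v : ℂ, ‖(c : ℂ) * u - c * v‖ = ‖u - v‖ := by
    intro u v
    rw [← mul_sub, norm_mul, Circle.norm_coe, one_mul]
  rw [rot_toE2, weight, weight, Fintype.sum_option, Fintype.sum_option]
  congr 1
  · simp [pts, Circle.norm_coe]
  · let σ : S ≃ S := Equiv.subtypeEquiv (Equiv.mulLeft₀ (c : ℂ) c.coe_ne_zero)
      fun ζ => (hc ζ).symm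
    rw [← Equiv.sum_comp σ]
    refine Finset.sum_congr rfl fun ζ _ => ?_
    have h0 : (σ ζ : ℂ) = c * ζ := rfl
    have h1 : pts S r (some (σ ζ)) = c * pts S r (some ζ) := by
      simp only [pts, h0]; ring
    rw [h1, hw (σ ζ) ζ, LinearIsometryEquiv.symm_apply_apply, LinearIsometryEquiv.symm_apply_apply,
      hn, norm_mul, Circle.norm_coe, one_mul]

lemma memDp_ball_weight (hS : ∀ ζ ∈ S, ‖ζ‖ = 1) (hr0 : 0 < r) (hr1 : r < 1) (hw : ∀ i, 0 < w i)
    (hw' : ∀ i j, w (some i) = w (some j)) (p : ℕ)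
    (hp : ∀ ζ, (Circle.exp (2 * Real.pi / p) : ℂ) * ζ ∈ S ↔ ζ ∈ S) :
    MemDp p (ball 0 1) (weight S w r) := by
  refine ⟨isLipschitzDomain_ball, simplyConnectedSpace_ball, image_rotBy_ball _,
    weight_nonneg hS hr0 hr1 fun i => (hw i).le, ?_, ?_, fun x _ => ?_⟩
  · obtain ⟨C, hC⟩ := (isCompact_sphere (0 : ℂ) 1).exists_bound_of_continuousOn
      (continuousOn_sum_poissonKernel (w := w) hS hr0 hr1)
    refine ⟨C, ?_⟩
    rw [frontier_ball _ one_ne_zero]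
    refine (ae_restrict_iff' isClosed_sphere.measurableSet).mpr (ae_of_all _ fun x hx => ?_)
    rw [← image_toE2_sphere] at hx
    obtain ⟨z, hz, rfl⟩ := hx
    rw [weight_toE2 hz]
    exact (le_abs_self _).trans (hC z hz)
  · rw [frontier_ball _ one_ne_zero]
    refine hausdorffMeasure_sphere_pos.trans_le (measure_mono fun x hx => ⟨hx, ?_⟩)
    exact weight_pos hS hr0 hr1 hw hx
  · rw [rotBy_eq_rot, weight_rot _ hp hw']

end Weight

section Energy
variable {V : ℂ → ℝ} {f : E2 → ℝ}

lemma integrableOn_norm_fderiv_sq (hV : ContDiff ℝ 1 V) :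
    IntegrableOn (fun z => ‖fderiv ℝ V z‖ ^ 2) (ball (0 : ℂ) 1) := by
  have hc : Continuous fun z => ‖fderiv ℝ V z‖ ^ 2 :=
    (hV.continuous_fderiv one_ne_zero).norm.pow 2
  exact (hc.continuousOn.integrableOn_compact (isCompact_closedBall 0 1)).mono_set
    ball_subset_closedBall

lemma dirEnergy_ball (hf : ContDiff ℝ 1 f) : dirEnergy (ball 0 1) f =
    ENNReal.ofReal (∫ z in ball (0 : ℂ) 1, ‖fderiv ℝ (f ∘ toE2) z‖ ^ 2) := by
  have hV : ContDiff ℝ 1 (f ∘ toE2) := hf.comp toE2.contDiff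
  have hb : toE2 ⁻¹' ball (0 : E2) 1 = ball (0 : ℂ) 1 := by
    rw [LinearIsometryEquiv.preimage_ball, map_zero]
  have hn : ∀ z : ℂ, ‖fderiv ℝ (f ∘ toE2) z‖ = ‖fderiv ℝ f (toE2 z)‖ := by
    intro z
    have := ContinuousLinearEquiv.comp_right_fderiv toE2.toContinuousLinearEquiv (f := f) (x := z)
    rw [LinearIsometryEquiv.coe_toContinuousLinearEquiv] at this
    rw [this]
    exact ContinuousLinearMap.opNorm_comp_linearIsometryEquiv _ toE2
  rw [dirEnergy, ← toE2.measurePreserving.setLIntegral_comp_preimage_emb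
    toE2.toHomeomorph.measurableEmbedding, hb,
    ofReal_integral_eq_lintegral_ofReal (integrableOn_norm_fderiv_sq hV)
      (ae_of_all _ fun z => by positivity)]
  refine lintegral_congr fun z => ?_
  rw [hn, ENNReal.ofReal_pow (norm_nonneg _), ofReal_norm]
  rfl

/-- A function with vanishing energy and vanishing boundary mean vanishes on the disk. -/
lemma eqOn_zero_of_energy_eq_zero (hV : ContDiff ℝ 1 V)
    (hE : ∫ z in ball (0 : ℂ) 1, ‖fderiv ℝ V z‖ ^ 2 = 0) (hm : cavg V = 0) :
    EqOn V 0 (closedBall 0 1) := by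
  have hc : Continuous fun z => ‖fderiv ℝ V z‖ ^ 2 :=
    (hV.continuous_fderiv one_ne_zero).norm.pow 2
  have h1 := (setIntegral_eq_zero_iff_of_nonneg_ae (ae_of_all _ fun z => by positivity)
    (integrableOn_norm_fderiv_sq hV)).mp hE
  have h2 := Measure.eqOn_open_of_ae_eq h1 isOpen_ball hc.continuousOn continuousOn_const
  obtain ⟨c, hc⟩ := isOpen_ball.exists_is_const_of_fderiv_eq_zero
    (convex_ball (0 : ℂ) 1).isPreconnected (hV.differentiable one_ne_zero).differentiableOn
    fun z hz => by simpa using h2 hz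
  have h3 : EqOn V (fun _ => c) (closedBall 0 1) := by
    rw [← closure_ball _ one_ne_zero]
    exact EqOn.closure hc hV.continuous continuous_const
  have h4 : c = 0 := by
    rw [← hm, cavg_congr fun z hz => h3 (sphere_subset_closedBall hz)]
    exact (Real.circleAverage_const c 0 1).symm
  rw [h4] at h3
  exact h3

end Energy

section Constraints
variable {S : Finset ℂ} {r : ℝ}

lemma exists_mem_constraints (hS : ∀ ζ ∈ S, ‖ζ‖ = 1) (hr0 : 0 < r) (hr1 : r < 1) (l k : ℕ)
    (hk : S.card + 2 * l < k) (U : Submodule ℝ (E2 → ℝ)) (hU : Module.finrank ℝ U = k + 1)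
    (hc : ∀ f ∈ U, Continuous f) :
    ∃ f ∈ U, f ≠ 0 ∧
      (∀ i, cavg (fun z => poissonKernel 0 (pts S r i) z * f (toE2 z)) = 0) ∧
      ∀ j < l + 1, j ≠ 0 → fcoeff (f ∘ toE2) j = 0 := by
  have hP := fun i => continuousOn_poissonKernel (admissible_pts hS hr0 hr1 i).norm_lt
  have hcU : ∀ f : U, ContinuousOn (fun z => (f : E2 → ℝ) (toE2 z)) (sphere 0 1) := fun f =>
    ((hc f f.2).comp toE2.continuous).continuousOn
  have hcU' : ∀ f : U, ContinuousOn (fun z => ((f : E2 → ℝ) (toE2 z) : ℂ)) (sphere 0 1) :=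
    fun f => continuousOn_ofReal (hcU f)
  have c3 : ContinuousOn (fun z : ℂ => conj z) (sphere 0 1) :=
    Complex.continuous_conj.continuousOn
  let Λ : U →ₗ[ℝ] (Option S → ℝ) × (Fin l → ℂ) :=
    { toFun := fun f =>
        (fun i => cavg (fun z => poissonKernel 0 (pts S r i) z * (f : E2 → ℝ) (toE2 z)),
          fun j => fcoeff ((f : E2 → ℝ) ∘ toE2) (j + 1))
      map_add' := by
        intro f g
        have h1 := hcU f
        have h2 := hcU g
        have h3 := hcU' f
        have h4 := hcU' g
        refine Prod.ext (funext fun i => ?_) (funext fun j => ?_)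
        · simp only [Submodule.coe_add, Pi.add_apply, Prod.fst_add, mul_add]
          exact cavg_add ((hP i).mul h1) ((hP i).mul h2)
        · simp only [fcoeff, Submodule.coe_add, Function.comp_apply, Pi.add_apply, Prod.snd_add,
            Complex.ofReal_add, add_mul]
          exact cavg_add (by fun_prop) (by fun_prop)
      map_smul' := by
        intro a f
        refine Prod.ext (funext fun i => ?_) (funext fun j => ?_)
        · simp only [Submodule.coe_smul, Pi.smul_apply, Prod.smul_fst, smul_eq_mul,
            RingHom.id_apply]
          rw [← cavg_const_mul_real]
          exact cavg_congr fun z _ => by ring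
        · simp only [fcoeff, Submodule.coe_smul, Function.comp_apply, Pi.smul_apply,
            Prod.smul_snd, smul_eq_mul, RingHom.id_apply, Complex.real_smul]
          rw [← cavg_const_mul]
          exact cavg_congr fun z _ => by push_cast; ring }
  have : Module.Finite ℝ U := Module.finite_of_finrank_pos (by omega)
  have hker : LinearMap.ker Λ ≠ ⊥ := by
    refine LinearMap.ker_ne_bot_of_finrank_lt ?_
    rw [hU, Module.finrank_prod, Module.finrank_pi_fintype, Module.finrank_pi_fintype]
    simp only [Module.finrank_self, Complex.finrank_real_complex, Finset.sum_const,
      Finset.card_univ, Fintype.card_option, Fintype.card_coe, Fintype.card_fin, smul_eq_mul]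
    omega
  obtain ⟨f, hf, hf0⟩ := Submodule.exists_mem_ne_zero_of_ne_bot hker
  have hΛ : Λ f = 0 := hf
  refine ⟨f, f.2, fun h => hf0 (Subtype.ext h), fun i => ?_, fun j hj hj0 => ?_⟩
  · exact congrFun (congrArg Prod.fst hΛ) i
  · obtain ⟨j, rfl⟩ := Nat.exists_eq_succ_of_ne_zero hj0
    exact congrFun (congrArg Prod.snd hΛ) ⟨j, by omega⟩

end Constraints

section Bound
variable {S : Finset ℂ} {w : Option S → ℝ} {L : Option S → ℕ}

lemma cavg_sum_poissonKernel_mul (hS : ∀ ζ ∈ S, ‖ζ‖ = 1) {r : ℝ} (hr0 : 0 < r) (hr1 : r < 1)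
    {g : ℂ → ℝ} (hg : ContinuousOn g (sphere 0 1)) :
    cavg (fun z => (∑ i, w i * poissonKernel 0 (pts S r i) z) * g z) =
      ∑ i, w i * cavg (fun z => poissonKernel 0 (pts S r i) z * g z) := by
  have hP := fun i => continuousOn_poissonKernel (admissible_pts hS hr0 hr1 i).norm_lt
  simp only [Finset.sum_mul]
  rw [cavg_sum _ fun i _ => by have := hP i; fun_prop]
  refine Finset.sum_congr rfl fun i _ => ?_
  rw [← cavg_const_mul_real]
  exact cavg_congr fun z _ => mul_assoc _ _ _

/-- For a suitable radius, the weighted disk has a large normalized eigenvalue. -/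
theorem exists_radius_le_steklovW_mul (hS : ∀ ζ ∈ S, ‖ζ‖ = 1) (hw0 : ∀ i, 0 < w i)
    (hwL : ∀ i, w i ≤ L i) (hL : ∀ i, 1 < L i → i = none) {k l : ℕ} (hl : L none = l + 1)
    (hk : S.card + 2 * l < k) {ε : ℝ} (hε : 0 < ε) :
    ∃ r : ℝ, 0 < r ∧ r < 1 ∧ ENNReal.ofReal (2 * Real.pi * (∑ i, w i) / (1 + ε)) ≤
      steklovW (ball 0 1) (weight S w r) k * Lweight (ball 0 1) (weight S w r) := by
  obtain ⟨r, hr0, hr1, hmain⟩ := exists_radius_sum_cavg_le hS (fun i => (hw0 i).le) hwL hL hε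
  refine ⟨r, hr0, hr1, ?_⟩
  have hadm := admissible_pts hS hr0 hr1
  obtain ⟨c, hc0, hct, hc⟩ := exists_lintegral_sphere_eq
  have hcw := continuousOn_sum_poissonKernel (w := w) hS hr0 hr1
  have hwpos : ∀ z ∈ sphere (0 : ℂ) 1, 0 ≤ ∑ i, w i * poissonKernel 0 (pts S r i) z :=
    fun z hz => Finset.sum_nonneg fun i _ =>
      mul_nonneg (hw0 i).le (poissonKernel_pos (hadm i).norm_lt hz).le
  have hfr : frontier (ball (0 : E2) 1) = sphere 0 1 := frontier_ball _ one_ne_zero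
  have hLw : Lweight (ball 0 1) (weight S w r) =
      c * ENNReal.ofReal (2 * Real.pi * ∑ i, w i) := by
    rw [Lweight, hfr, hc _ hcw hwpos _ fun z hz => weight_toE2 hz]
    have := cavg_sum_poissonKernel_mul (w := w) hS hr0 hr1 (g := fun _ => 1) (by fun_prop)
    simp only [mul_one] at this
    rw [this]
    simp only [fun i => cavg_poissonKernel (hadm i), mul_one]
  have hσ : (c * ENNReal.ofReal (1 + ε))⁻¹ ≤ steklovW (ball 0 1) (weight S w r) k := by
    refine le_iInf fun U => le_iInf fun hU => le_iInf fun hsm => le_iInf fun _ =>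
      le_iInf fun hinj => ?_
    have hsm1 : ∀ f ∈ U, ContDiff ℝ 1 f := fun f hf => (hsm f hf).of_le (by exact_mod_cast le_top)
    obtain ⟨f, hfU, hf0, hmean, hcoef⟩ := exists_mem_constraints hS hr0 hr1 l k hk U hU
      fun f hf => (hsm1 f hf).continuous
    have hne : ¬EqOn f 0 (closure (ball 0 1)) := fun h => hf0 (hinj f hfU h)
    refine le_iSup₂_of_le f hfU (le_iSup_of_le hne ?_)
    set V : ℂ → ℝ := f ∘ toE2 with hVdef
    have hV : ContDiff ℝ 1 V := (hsm1 f hfU).comp toE2.contDiff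
    have hB := hmain V hV hmean (by rw [hl]; exact hcoef)
    set E : ℝ := ∫ z in ball (0 : ℂ) 1, ‖fderiv ℝ V z‖ ^ 2 with hE
    have hE0 : 0 < E := by
      refine lt_of_le_of_ne (integral_nonneg fun z => by positivity) fun h0 => hne ?_
      have hm0 : cavg V = 0 := by
        rw [← hmean none]
        refine cavg_congr fun z hz => ?_
        rw [mem_sphere_zero_iff_norm] at hz
        simp [pts, poissonKernel_def, hz, hVdef]
      have hz := eqOn_zero_of_energy_eq_zero hV h0.symm hm0
      rw [closure_ball _ one_ne_zero]
      intro x hx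
      have := hz (x := toE2.symm x) (by simpa using hx)
      simpa [hVdef] using this
    have hbd : bdryInt (sphere 0 1) (weight S w r) f ≤ c * ENNReal.ofReal ((1 + ε) * E) := by
      have hVc : ContinuousOn V (sphere 0 1) := hV.continuous.continuousOn
      rw [bdryInt, hc (fun z => (∑ i, w i * poissonKernel 0 (pts S r i) z) * V z ^ 2)
        (by fun_prop) (fun z hz => mul_nonneg (hwpos z hz) (sq_nonneg _)) _
        fun z hz => by rw [weight_toE2 hz, hVdef, Function.comp_apply],
        cavg_sum_poissonKernel_mul hS hr0 hr1 (by fun_prop)]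
      gcongr
    rw [rayleigh, hfr, dirEnergy_ball (hsm1 f hfU), ← hVdef, ← hE]
    calc (c * ENNReal.ofReal (1 + ε))⁻¹
        = ENNReal.ofReal E / (c * ENNReal.ofReal ((1 + ε) * E)) := by
          have h1 : ENNReal.ofReal E ≠ 0 := (ENNReal.ofReal_pos.mpr hE0).ne'
          rw [ENNReal.ofReal_mul (by positivity), ← mul_assoc]
          nth_rewrite 1 [← one_mul (ENNReal.ofReal E)]
          rw [ENNReal.mul_div_mul_right _ _ h1 ENNReal.ofReal_ne_top, one_div]
      _ ≤ _ := ENNReal.div_le_div_left hbd _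
  calc ENNReal.ofReal (2 * Real.pi * (∑ i, w i) / (1 + ε))
      = (c * ENNReal.ofReal (1 + ε))⁻¹ * (c * ENNReal.ofReal (2 * Real.pi * ∑ i, w i)) := by
        rw [ENNReal.ofReal_div_of_pos (by positivity), ENNReal.mul_inv (Or.inl hc0) (Or.inl hct),
          div_eq_mul_inv, mul_mul_mul_comm, ENNReal.inv_mul_cancel hc0 hct, one_mul, mul_comm]
    _ ≤ _ := by rw [hLw]; gcongr

end Bound

/-- The weight at the origin is `p / 2`, the other weights are one. -/
def coeff (p : ℕ) (S : Finset ℂ) : Option S → ℝ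
  | none => p / 2
  | some _ => 1

/-- The number of controlled modes at each point. -/
def modes (p : ℕ) (S : Finset ℂ) : Option S → ℕ
  | none => (p + 1) / 2
  | some _ => 1

theorem ofReal_div_le_sigmaP {p k : ℕ} (hp : 2 ≤ p) (hk : 2 * p ≤ k) {ε : ℝ} (hε : 0 < ε) :
    ENNReal.ofReal ((2 * ((k / p : ℕ) : ℝ) - 1) * p * Real.pi / (1 + ε)) ≤ SigmaP p k := by
  have hm : 2 ≤ k / p := (Nat.le_div_iff_mul_le (by omega)).mpr hk
  have hmk : p * (k / p) ≤ k := Nat.mul_div_le k p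
  obtain ⟨m, hm1⟩ : ∃ m, k / p = m + 1 := ⟨k / p - 1, by omega⟩
  rw [hm1] at hm hmk ⊢
  have hn : 0 < p * m := Nat.mul_pos (by omega) (by omega)
  set S : Finset ℂ := Polynomial.nthRootsFinset (p * m) 1 with hSdef
  have hmem : ∀ ζ : ℂ, ζ ∈ S ↔ ζ ^ (p * m) = 1 := fun ζ => Polynomial.mem_nthRootsFinset hn 1
  have hcard : S.card = p * m := (Complex.isPrimitiveRoot_exp _ hn.ne').card_nthRootsFinset
  have hS : ∀ ζ ∈ S, ‖ζ‖ = 1 := fun ζ hζ =>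
    Complex.norm_eq_one_of_pow_eq_one ((hmem ζ).mp hζ) hn.ne'
  have hp0 : (0 : ℝ) < p := by exact_mod_cast (by omega : 0 < p)
  have hw0 : ∀ i, 0 < coeff p S i := by
    rintro (_ | i)
    · exact half_pos hp0
    · exact one_pos
  have hwL : ∀ i, coeff p S i ≤ modes p S i := by
    rintro (_ | i)
    · have : p ≤ 2 * ((p + 1) / 2) := by omega
      have : (p : ℝ) ≤ 2 * ((p + 1) / 2 : ℕ) := by exact_mod_cast this
      change (p : ℝ) / 2 ≤ ((p + 1) / 2 : ℕ)
      linarith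
    · simp [coeff, modes]
  have hL : ∀ i, 1 < modes p S i → i = none := by
    rintro (_ | i) h
    · rfl
    · exact absurd h (lt_irrefl 1)
  have hl : modes p S none = ((p + 1) / 2 - 1) + 1 := by
    change (p + 1) / 2 = _
    omega
  obtain ⟨r, hr0, hr1, hle⟩ := exists_radius_le_steklovW_mul hS hw0 hwL hL (k := k) hl
    (by rw [hcard]; rw [mul_add, mul_one] at hmk; omega) hε
  have hsum : 2 * Real.pi * ∑ i, coeff p S i = (2 * ((m + 1 : ℕ) : ℝ) - 1) * p * Real.pi := by
    rw [Fintype.sum_option]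
    simp only [coeff, Finset.sum_const, Finset.card_univ, Fintype.card_coe, hcard, nsmul_eq_mul]
    push_cast; ring
  rw [hsum] at hle
  have hrot : ∀ ζ, (Circle.exp (2 * Real.pi / p) : ℂ) * ζ ∈ S ↔ ζ ∈ S := by
    intro ζ
    have h1 : (Circle.exp (2 * Real.pi / p) : ℂ) ^ p = 1 := by
      rw [Circle.coe_exp, ← Complex.exp_nat_mul]
      have : (p : ℂ) ≠ 0 := by exact_mod_cast hp0.ne'
      rw [← Complex.exp_two_pi_mul_I]
      congr 1
      push_cast
      field_simp
    rw [hmem, hmem, mul_pow, pow_mul, h1, one_pow, one_mul]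
  exact hle.trans (le_iSup₂_of_le (ball 0 1) (weight S (coeff p S) r)
    (le_iSup_of_le (memDp_ball_weight hS hr0 hr1 hw0 (fun _ _ => rfl) p hrot) le_rfl))

end DiskSteklov

theorem statement8 (p k : ℕ) (hp : 2 ≤ p) (hk : 2 * p ≤ k) :
    ENNReal.ofReal ((2 * ((k / p : ℕ) : ℝ) - 1) * p * Real.pi) ≤ SigmaP p k := by
  have hlim : Tendsto
      (fun ε : ℝ => ENNReal.ofReal ((2 * ((k / p : ℕ) : ℝ) - 1) * p * Real.pi / (1 + ε)))
      (𝓝[>] 0) (𝓝 (ENNReal.ofReal ((2 * ((k / p : ℕ) : ℝ) - 1) * p * Real.pi))) := by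
    have hc : ContinuousAt
        (fun ε : ℝ => (2 * ((k / p : ℕ) : ℝ) - 1) * p * Real.pi / (1 + ε)) 0 :=
      continuousAt_const.div (by fun_prop) (by norm_num)
    have h := hc.tendsto
    rw [add_zero, div_one] at h
    exact (ENNReal.tendsto_ofReal h).mono_left nhdsWithin_le_nhds
  exact le_of_tendsto hlim (by
    filter_upwards [self_mem_nhdsWithin] with ε hε using
      DiskSteklov.ofReal_div_le_sigmaP hp hk hε)

end
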